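/- Main theorem: Let G < GL(V) be a finite abelian group acting linearly on a finite-dimensional vector space V over any field k. Then k[V]^G is a polynomial ring (generated by dim V algebraically independent homogeneous invariants) if and only if G is generated by pseudo-reflections and there exists a surjective graded k[V]^G-linear projection k[V] → k[V]^G. -/

import Mathlib

open MvPolynomial

set_option synthInstance.maxHeartbeats 1000000
set_option maxHeartbeats 1000000

variable {k : Type*} [Field k] {ι : Type*} [Fintype ι] [DecidableEq ι]

noncomputable def galAct (M : Matrix.GeneralLinearGroup ι k) :
    MvPolynomial ι k →ₐ[k] MvPolynomial ι k :=
  aeval fun i => ∑ j, (((M⁻¹ : Matrix.GeneralLinearGroup ι k) : Matrix ι ι k) i j) • X j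

def invariants (G : Subgroup (Matrix.GeneralLinearGroup ι k)) :
    Subalgebra k (MvPolynomial ι k) where
  carrier := {p | ∀ σ ∈ G, galAct σ p = p}
  mul_mem' := fun ha hb σ hσ => by rw [map_mul, ha σ hσ, hb σ hσ]
  add_mem' := fun ha hb σ hσ => by rw [map_add, ha σ hσ, hb σ hσ]
  algebraMap_mem' := fun r σ hσ => by simp [galAct]

noncomputable def fixedSpace (M : Matrix.GeneralLinearGroup ι k) : Submodule k (ι → k) :=
  LinearMap.ker (Matrix.mulVecLin ((M : Matrix ι ι k) - 1))

noncomputable def moveSpace (M : Matrix.GeneralLinearGroup ι k) : Submodule k (ι → k) :=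
  LinearMap.range (Matrix.mulVecLin ((M : Matrix ι ι k) - 1))

def IsPseudoReflection (M : Matrix.GeneralLinearGroup ι k) : Prop :=
  Module.finrank k (moveSpace M) = 1

def IsTransvection (M : Matrix.GeneralLinearGroup ι k) : Prop :=
  IsPseudoReflection M ∧ moveSpace M ≤ fixedSpace M

noncomputable def linForm (y : Module.Dual k (ι → k)) : MvPolynomial ι k :=
  ∑ i, C (y (Pi.single i 1)) * X i

noncomputable def hilbertIdeal (G : Subgroup (Matrix.GeneralLinearGroup ι k)) :
    Ideal (MvPolynomial ι k) :=
  Ideal.span {p | p ∈ invariants G ∧ ∃ d, 0 < d ∧ p.IsHomogeneous d}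

def DSP (G : Subgroup (Matrix.GeneralLinearGroup ι k)) : Prop :=
  ∃ π : MvPolynomial ι k →ₗ[↥(invariants G)] ↥(invariants G),
    Function.Surjective π ∧
    ∀ (p : MvPolynomial ι k) (d : ℕ), p.IsHomogeneous d →
      ((π p : MvPolynomial ι k)).IsHomogeneous d

noncomputable def fixedSubmodule (G : Subgroup (Matrix.GeneralLinearGroup ι k)) :
    Submodule k (ι → k) := ⨅ σ ∈ G, fixedSpace σ

/-- The Taylor expansion of a polynomial in the `i`-th variable: its coefficients are the
Hasse derivatives. -/
noncomputable def taylorAt (i : ι) :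
    MvPolynomial ι k →ₐ[k] Polynomial (MvPolynomial ι k) :=
  aeval fun j => if j = i then Polynomial.C (X j) + Polynomial.X else Polynomial.C (X j)

theorem taylorAt_X_self (i : ι) :
    taylorAt (k := k) i (X i) = Polynomial.C (X i) + Polynomial.X := by
  simp [taylorAt]

theorem taylorAt_X_of_ne {i j : ι} (h : j ≠ i) :
    taylorAt (k := k) i (X j) = Polynomial.C (X j) := by
  simp [taylorAt, h]

theorem taylorAt_monomial (i : ι) (α : ι →₀ ℕ) (c : k) :
    taylorAt i (monomial α c) =
      Polynomial.C (monomial (α.erase i) c) * (Polynomial.X + Polynomial.C (X i)) ^ α i := by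
  have h1 : monomial α c = monomial (α.erase i) c * (X i) ^ (α i) := by
    rw [X_pow_eq_monomial, monomial_mul, mul_one, Finsupp.erase_add_single]
  have h2 : taylorAt i (monomial (α.erase i) c) = Polynomial.C (monomial (α.erase i) c) := by
    rw [taylorAt, aeval_monomial, monomial_eq, map_mul]
    congr 1
    rw [Finsupp.prod, Finsupp.prod, map_prod]
    refine Finset.prod_congr rfl fun j hj => ?_
    have : j ≠ i := by
      rintro rfl
      simp at hj
    simp [this]
  rw [h1, map_mul, h2, map_pow, taylorAt_X_self, add_comm]

theorem coeff_taylorAt (i : ι) (f : MvPolynomial ι k) (a : ℕ) (γ : ι →₀ ℕ) :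
    coeff γ ((taylorAt i f).coeff a) =
      (γ i + a).choose a * coeff (γ + Finsupp.single i a) f := by
  induction f using MvPolynomial.induction_on' with
  | monomial α c =>
    rw [taylorAt_monomial, Polynomial.coeff_C_mul, Polynomial.coeff_X_add_C_pow, X_pow_eq_monomial,
      ← mul_assoc, monomial_mul, mul_one, ← map_natCast (C : k →+* MvPolynomial ι k), mul_comm,
      coeff_C_mul, coeff_monomial, coeff_monomial]
    by_cases h : α = γ + Finsupp.single i a
    · subst h
      have : Finsupp.erase i (γ + Finsupp.single i a) +
          Finsupp.single i ((γ + Finsupp.single i a) i - a) = γ := by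
        ext j
        by_cases hj : j = i
        · subst hj; simp
        · simp [hj, Ne.symm hj]
      rw [if_pos this, if_pos rfl]
      simp
    · rw [if_neg h, mul_zero]
      split_ifs with h'
      · have hlt : α i < a := by
          by_contra hle
          apply h
          rw [← h']
          ext j
          by_cases hj : j = i
          · subst hj; simp; omega
          · simp [hj, Ne.symm hj]
        simp [Nat.choose_eq_zero_of_lt hlt]
      · simp
  | add p q hp hq =>
    rw [map_add, Polynomial.coeff_add, coeff_add, hp, hq, coeff_add, mul_add]

/-- A set of polynomials closed under taking homogeneous components. -/
def IsGradedSubalgebra (T : Subalgebra k (MvPolynomial ι k)) : Prop :=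
  ∀ f ∈ T, ∀ d, homogeneousComponent d f ∈ T

/-- Stability under all Hasse derivatives in the variables from `s`. -/
def HasseStable (s : Finset ι) (T : Subalgebra k (MvPolynomial ι k)) : Prop :=
  ∀ i ∈ s, ∀ f ∈ T, ∀ a, (taylorAt i f).coeff a ∈ T

theorem mem_supported_iff_coeff {s : Set ι} {f : MvPolynomial ι k} :
    f ∈ supported k s ↔ ∀ α, coeff α f ≠ 0 → ∀ i, α i ≠ 0 → i ∈ s := by
  rw [mem_supported]
  constructor
  · intro h α hα i hi
    exact h ((mem_vars_iff_mem_support i).2 ⟨α, mem_support_iff.2 hα, Finsupp.mem_support_iff.2 hi⟩)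
  · intro h i hi
    obtain ⟨α, hα, hi⟩ := (mem_vars_iff_mem_support i).1 hi
    exact h α (mem_support_iff.1 hα) i (Finsupp.mem_support_iff.1 hi)

theorem exists_expChar_pow_dvd_choose_ne_zero {a : ℕ} (ha : a ≠ 0) :
    ∃ v, ringExpChar k ^ v ∣ a ∧ (a.choose (ringExpChar k ^ v) : k) ≠ 0 := by
  classical
  set p := ringExpChar k with hp
  have : ∀ p, ExpChar k p → ∃ v b, a = p ^ v * b ∧ (b : k) ≠ 0 := by
    rintro p (_ | h)
    · exact ⟨0, a, by simp, by exact_mod_cast ha⟩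
    · obtain ⟨v, b, hb, h2⟩ := Nat.exists_eq_pow_mul_and_not_dvd ha p h.ne_one
      exact ⟨v, b, h2, by rwa [Ne, CharP.cast_eq_zero_iff k p]⟩
  obtain ⟨v, b, hab, hb⟩ := this p inferInstance
  refine ⟨v, ⟨b, hab⟩, ?_⟩
  have hpos : 0 < p ^ v := pow_pos (expChar_pos k p) v
  have h1 : ((1 + Polynomial.X : Polynomial k) ^ a).coeff (p ^ v) = (a.choose (p ^ v) : k) :=
    Polynomial.coeff_one_add_X_pow k a _
  have h2 : (1 + Polynomial.X : Polynomial k) ^ a =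
      Polynomial.expand k (p ^ v) ((1 + Polynomial.X) ^ b) := by
    rw [hab, pow_mul, add_pow_expChar_pow]
    simp
  rw [← h1, h2]
  have h3 := Polynomial.coeff_expand_mul hpos ((1 + Polynomial.X : Polynomial k) ^ b) 1
  rw [one_mul] at h3
  rw [h3, Polynomial.coeff_one_add_X_pow]
  simpa using hb

theorem exists_coeff_single_ne_zero {s : Finset ι} {T : Subalgebra k (MvPolynomial ι k)}
    (hs : T ≤ supported k (s : Set ι)) (hT : HasseStable s T) {f : MvPolynomial ι k} (hf : f ∈ T)
    {α : ι →₀ ℕ} (hα : coeff α f ≠ 0) (i : ι) :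
    ∃ g ∈ T, coeff (Finsupp.single i (α i)) g ≠ 0 := by
  have key : ∀ u : Finset ι, ∃ g ∈ T, coeff (α.filter (· ∉ u)) g ≠ 0 := by
    intro u
    induction u using Finset.induction_on with
    | empty =>
      refine ⟨f, hf, ?_⟩
      have : α.filter (· ∉ (∅ : Finset ι)) = α := by ext j; simp [Finsupp.filter_apply]
      rwa [this]
    | insert j u hj ih =>
      obtain ⟨g, hg, hc⟩ := ih
      by_cases h0 : α j = 0
      · refine ⟨g, hg, ?_⟩
        have : α.filter (· ∉ insert j u) = α.filter (· ∉ u) := by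
          ext l
          by_cases hl : l = j
          · subst hl; simp [Finsupp.filter_apply, h0]
          · simp [Finsupp.filter_apply, hl]
        rwa [this]
      · have hjs : j ∈ s := mem_supported_iff_coeff.1 (hs hf) α hα j h0
        refine ⟨_, hT j hjs g hg (α j), ?_⟩
        have h1 : α.filter (· ∉ insert j u) + Finsupp.single j (α j) = α.filter (· ∉ u) := by
          ext l
          by_cases hl : l = j
          · subst hl; simp [Finsupp.filter_apply, hj]
          · simp [Finsupp.filter_apply, hl, Ne.symm hl]
        have h2 : α.filter (· ∉ insert j u) j = 0 := by simp [Finsupp.filter_apply]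
        rw [coeff_taylorAt, h1, h2]
        simpa using hc
  obtain ⟨g, hg, hc⟩ := key (Finset.univ.erase i)
  refine ⟨g, hg, ?_⟩
  have : α.filter (· ∉ Finset.univ.erase i) = Finsupp.single i (α i) := by
    ext l
    by_cases hl : l = i
    · subst hl; simp [Finsupp.filter_apply]
    · simp [Finsupp.filter_apply, hl, Ne.symm hl]
  rwa [this] at hc

theorem exists_isHomogeneous_expChar_pow {s : Finset ι} {T : Subalgebra k (MvPolynomial ι k)}
    (hs : T ≤ supported k (s : Set ι)) (hT : HasseStable s T) (hgr : IsGradedSubalgebra T)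
    {f : MvPolynomial ι k} (hf : f ∈ T)
    {α : ι →₀ ℕ} (hα : coeff α f ≠ 0) {i : ι} (hi : α i ≠ 0) :
    ∃ v, ringExpChar k ^ v ∣ α i ∧ ∃ h ∈ T, h.IsHomogeneous (ringExpChar k ^ v) ∧
      coeff (Finsupp.single i (ringExpChar k ^ v)) h ≠ 0 := by
  obtain ⟨g, hg, hc⟩ := exists_coeff_single_ne_zero hs hT hf hα i
  obtain ⟨v, hv, hch⟩ := exists_expChar_pow_dvd_choose_ne_zero (k := k) hi
  have hle := Nat.le_of_dvd (Nat.pos_of_ne_zero hi) hv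
  refine ⟨v, hv, homogeneousComponent (ringExpChar k ^ v)
    ((taylorAt i g).coeff (α i - ringExpChar k ^ v)), hgr _
      (hT i (mem_supported_iff_coeff.1 (hs hf) α hα i hi) g hg _) _,
      homogeneousComponent_isHomogeneous _ _, ?_⟩
  rw [coeff_homogeneousComponent, if_pos (by simp), coeff_taylorAt, ← Finsupp.single_add]
  have h1 : ringExpChar k ^ v + (α i - ringExpChar k ^ v) = α i := by omega
  simp only [Finsupp.single_eq_same, h1]
  rw [Nat.choose_symm hle]
  exact mul_ne_zero hch hc

theorem homogeneousComponent_expand {q : ℕ} (hq : 0 < q) (f : MvPolynomial ι k) (d : ℕ) :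
    homogeneousComponent (q * d) (expand q f) = expand q (homogeneousComponent d f) := by
  induction f using MvPolynomial.induction_on' with
  | monomial α c =>
    rw [MvPolynomial.expand_monomial, homogeneousComponent_of_mem (n := α.degree) (isHomogeneous_monomial c rfl),
      homogeneousComponent_of_mem (n := q * α.degree) (isHomogeneous_monomial c (by simp))]
    by_cases h : d = α.degree
    · simp [h, MvPolynomial.expand_monomial]
    · rw [if_neg h, if_neg, map_zero]
      intro h'
      exact h (Nat.eq_of_mul_eq_mul_left hq h')
  | add p q hp hq => simp only [map_add, hp, hq]

theorem isHomogeneous_expand {q d : ℕ} (hq : 0 < q) {f : MvPolynomial ι k}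
    (hf : f.IsHomogeneous d) : (expand q f).IsHomogeneous (q * d) := by
  have := homogeneousComponent_expand hq f d
  rw [homogeneousComponent_eq_self hf] at this
  rw [← this]
  exact homogeneousComponent_isHomogeneous _ _

theorem mem_range_expand {q : ℕ} {f : MvPolynomial ι k}
    (h : ∀ α, coeff α f ≠ 0 → ∀ i, q ∣ α i) : ∃ g, expand q g = f := by
  change f ∈ (expand q : MvPolynomial ι k →ₐ[k] MvPolynomial ι k).range
  rw [f.as_sum]
  refine Subalgebra.sum_mem _ fun α hα => ?_
  choose β hβ using h α (mem_support_iff.1 hα)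
  refine ⟨monomial (Finsupp.equivFunOnFinite.symm β) (coeff α f), ?_⟩
  change expand q _ = _
  rw [MvPolynomial.expand_monomial]
  congr 2
  ext i
  simp [hβ]

theorem taylorAt_expand {q : ℕ} (hq : ∃ v, q = ringExpChar k ^ v) (i : ι) (f : MvPolynomial ι k) :
    taylorAt i (expand q f) =
      Polynomial.expand _ q ((taylorAt i f).map (expand q : _ →ₐ[k] _).toRingHom) := by
  obtain ⟨v, rfl⟩ := hq
  let L : MvPolynomial ι k →ₐ[k] Polynomial (MvPolynomial ι k) :=
    (taylorAt i).comp (expand (ringExpChar k ^ v))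
  let P : MvPolynomial ι k →ₐ[k] Polynomial (MvPolynomial ι k) :=
    ((Polynomial.expand (MvPolynomial ι k) (ringExpChar k ^ v)).restrictScalars k).comp
      ((Polynomial.mapAlgHom (expand (ringExpChar k ^ v))).comp (taylorAt i))
  have : L = P := by
    refine MvPolynomial.algHom_ext fun j => ?_
    simp only [L, P, AlgHom.comp_apply, expand_X, map_pow, AlgHom.restrictScalars_apply]
    by_cases h : j = i
    · subst h
      have : ExpChar (Polynomial (MvPolynomial ι k)) (ringExpChar k) :=
        expChar_of_injective_algebraMap (algebraMap k _).injective _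
      rw [taylorAt_X_self, add_pow_expChar_pow]
      simp
    · rw [taylorAt_X_of_ne h]
      simp
  exact DFunLike.congr_fun this f

theorem MvPolynomial.IsHomogeneous.eq_single_of_coeff_ne_zero {f : MvPolynomial ι k} (hf : f.IsHomogeneous 1)
    {α : ι →₀ ℕ} (hα : coeff α f ≠ 0) {i : ι} (hi : α i ≠ 0) : α = Finsupp.single i 1 := by
  have h1 : α.degree = 1 := by
    by_contra h
    exact hα (hf.coeff_eq_zero h)
  have h2 : α i + ∑ j ∈ Finset.univ.erase i, α j = 1 := by
    rw [Finset.add_sum_erase _ _ (Finset.mem_univ i), ← h1, Finsupp.degree_eq_sum]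
  have h3 : ∀ j ∈ Finset.univ.erase i, α j = 0 := by
    apply Finset.sum_eq_zero_iff.1
    omega
  ext j
  by_cases hj : j = i
  · subst hj
    simp
    omega
  · rw [h3 j (by simp [hj])]
    simp [hj]

theorem exists_linear_shift {s : Finset ι} {T : Subalgebra k (MvPolynomial ι k)}
    (hs : T ≤ supported k (s : Set ι)) (hT : HasseStable s T) {l : MvPolynomial ι k}
    (hl : l ∈ T) (hl1 : l.IsHomogeneous 1) {i : ι} (hi : coeff (Finsupp.single i 1) l ≠ 0) :
    T ≤ Algebra.adjoin k
      (insert l ((T ⊓ supported k (s.erase i : Set ι) : Subalgebra k _) : Set _)) := by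
  set c := coeff (Finsupp.single i 1) l with hc
  have his : i ∈ s := mem_supported_iff_coeff.1 (hs hl) _ hi i (by simp)
  let r : MvPolynomial ι k →ₐ[k] MvPolynomial ι k :=
    aeval fun j => if j = i then X j - c⁻¹ • l else X j
  have hr_eval : ∀ f, r f = (taylorAt i f).eval (-(c⁻¹ • l)) := by
    intro f
    have : r = ((Polynomial.aeval (-(c⁻¹ • l))).restrictScalars k).comp (taylorAt i) := by
      refine MvPolynomial.algHom_ext fun j => ?_
      by_cases h : j = i
      · subst h; simp [r, taylorAt_X_self, sub_eq_add_neg]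
      · simp [r, taylorAt_X_of_ne h, h]
    rw [this]
    simp [Polynomial.aeval_def, Polynomial.eval₂_eq_eval_map]
  have hrT : ∀ f ∈ T, r f ∈ T := by
    intro f hf
    rw [hr_eval, Polynomial.eval_eq_sum_range]
    exact sum_mem fun a _ => mul_mem (hT i his f hf a)
      (pow_mem (neg_mem (T.smul_mem hl _)) _)
  have hrs : ∀ f ∈ supported k (s : Set ι), r f ∈ supported k (s.erase i : Set ι) := by
    have : supported k (s : Set ι) ≤ (supported k (s.erase i : Set ι)).comap r := by
      rw [supported_eq_adjoin_X]
      refine Algebra.adjoin_le ?_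
      rintro _ ⟨j, hj, rfl⟩
      change r (X j) ∈ supported k (s.erase i : Set ι)
      by_cases h : j = i
      · subst h
        have hrX : r (X j) = X j - c⁻¹ • l := by simp [r]
        rw [hrX]
        refine mem_supported_iff_coeff.2 fun α hα m hm => ?_
        have h1 : (X j - c⁻¹ • l).IsHomogeneous 1 := by
          refine IsHomogeneous.sub (isHomogeneous_X k j) ?_
          exact (homogeneousSubmodule ι k 1).smul_mem _ hl1
        have h2 := h1.eq_single_of_coeff_ne_zero hα hm
        have h3 : X j - c⁻¹ • l ∈ supported k (s : Set ι) :=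
          sub_mem (X_mem_supported.2 hj) (Subalgebra.smul_mem _ (hs hl) _)
        have h4 := mem_supported_iff_coeff.1 h3 α hα m hm
        simp only [Finset.coe_erase, Set.mem_diff, Set.mem_singleton_iff]
        refine ⟨h4, ?_⟩
        rintro rfl
        apply hα
        rw [h2, coeff_sub, coeff_smul, ← hc, coeff_X, smul_eq_mul, inv_mul_cancel₀ hi, if_pos rfl,
          sub_self]
      · have hrX : r (X j) = X j := by simp [r, h]
        rw [hrX]
        apply X_mem_supported.2
        simp [h]
        exact hj
    exact this
  intro f hf
  let φ : Polynomial (MvPolynomial ι k) →ₐ[k] MvPolynomial ι k :=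
    ((Polynomial.aeval (c⁻¹ • l)).restrictScalars k).comp (Polynomial.mapAlgHom r)
  have hφ : φ.comp (taylorAt i) = AlgHom.id k _ := by
    refine MvPolynomial.algHom_ext fun j => ?_
    by_cases h : j = i
    · subst h; simp [φ, r, taylorAt_X_self]
    · simp [φ, r, taylorAt_X_of_ne h, h]
  have hf2 : f = φ (taylorAt i f) := by
    conv_lhs => rw [← AlgHom.id_apply (R := k) f, ← hφ]
    rfl
  rw [hf2]
  have hφ2 : φ (taylorAt i f) = Polynomial.eval₂ (r : _ →+* _) (c⁻¹ • l) (taylorAt i f) := by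
    simp [φ, Polynomial.eval₂_eq_eval_map]
  rw [hφ2, Polynomial.eval₂_eq_sum_range]
  refine sum_mem fun a _ => mul_mem ?_ (pow_mem (Subalgebra.smul_mem _ ?_ _) _)
  · refine Algebra.subset_adjoin (Set.mem_insert_of_mem _ ?_)
    have := hT i his f hf a
    exact ⟨hrT _ this, hrs _ (hs this)⟩
  · exact Algebra.subset_adjoin (Set.mem_insert _ _)

theorem HasseStable.inf_supported {s : Finset ι} {T : Subalgebra k (MvPolynomial ι k)}
    (hT : HasseStable s T) (i : ι) :
    HasseStable (s.erase i) (T ⊓ supported k (s.erase i : Set ι)) := by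
  rintro j hj f ⟨hf, hfs⟩ a
  refine ⟨hT j (Finset.mem_of_mem_erase hj) f hf a, mem_supported_iff_coeff.2 fun α hα m hm => ?_⟩
  rw [coeff_taylorAt] at hα
  refine mem_supported_iff_coeff.1 hfs _ (right_ne_zero_of_mul hα) m ?_
  simp [hm]

theorem IsGradedSubalgebra.inf_supported {T : Subalgebra k (MvPolynomial ι k)}
    (hT : IsGradedSubalgebra T) (s : Set ι) : IsGradedSubalgebra (T ⊓ supported k s) := by
  rintro f ⟨hf, hfs⟩ d
  refine ⟨hT f hf d, mem_supported_iff_coeff.2 fun α hα m hm => ?_⟩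
  rw [coeff_homogeneousComponent] at hα
  split_ifs at hα with h
  · exact mem_supported_iff_coeff.1 hfs _ hα m hm
  · exact absurd rfl hα

/-- A graded subalgebra of a polynomial ring in the variables from `s` that is stable under the
Hasse derivatives in these variables has `#s` homogeneous generators of positive degree. -/
theorem exists_generators_of_hasseStable (s : Finset ι) :
    ∀ T : Subalgebra k (MvPolynomial ι k), T ≤ supported k (s : Set ι) → HasseStable s T →
      IsGradedSubalgebra T → ∃ g : ι → MvPolynomial ι k,
        (∀ i, ∃ d, 0 < d ∧ (g i).IsHomogeneous d) ∧ T = Algebra.adjoin k (g '' s) := by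
  induction hn : s.card using Nat.strong_induction_on generalizing s with
  | _ N IH =>
  intro T hs hT hgr
  set p := ringExpChar k with hp
  have hppos : 0 < p := expChar_pos k p
  by_cases hex : ∃ v, ∃ h ∈ T, h.IsHomogeneous (p ^ v) ∧ h ≠ 0
  · classical
    let v := Nat.find hex
    obtain ⟨h, hhT, hh, hh0⟩ := Nat.find_spec hex
    change h.IsHomogeneous (p ^ v) at hh
    have hqpos : 0 < p ^ v := pow_pos hppos v
    have hdvd : ∀ f ∈ T, ∀ α, coeff α f ≠ 0 → ∀ i, p ^ v ∣ α i := by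
      intro f hf α hα i
      by_cases hi : α i = 0
      · simp [hi]
      · obtain ⟨w, hw, g, hg, hg1, hg2⟩ := exists_isHomogeneous_expChar_pow hs hT hgr hf hα hi
        refine (pow_dvd_pow p (Nat.find_min' hex ⟨g, hg, hg1, ?_⟩)).trans hw
        rintro rfl
        simp at hg2
    set q := p ^ v with hq
    let T₁ := T.comap (expand q)
    have hTT₁ : T = T₁.map (expand q) := by
      apply le_antisymm
      · intro f hf
        obtain ⟨g, rfl⟩ := mem_range_expand (hdvd f hf)
        exact ⟨g, hf, rfl⟩
      · rintro _ ⟨g, hg, rfl⟩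
        exact hg
    have hs₁ : T₁ ≤ supported k (s : Set ι) := by
      intro f hf
      refine mem_supported_iff_coeff.2 fun α hα i hi => ?_
      refine mem_supported_iff_coeff.1 (hs hf) (q • α) ?_ i ?_
      · change coeff (q • α) (expand q f) ≠ 0
        rwa [coeff_expand_smul _ hqpos.ne']
      · simp [hi, hqpos.ne']
    have hT₁ : HasseStable s T₁ := by
      intro i hi f hf a
      have := hT i hi _ hf (a * q)
      change (taylorAt i (expand q f)).coeff _ ∈ T at this
      rw [taylorAt_expand ⟨v, rfl⟩, Polynomial.coeff_expand_mul hqpos, Polynomial.coeff_map] at this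
      exact this
    have hgr₁ : IsGradedSubalgebra T₁ := by
      intro f hf d
      have := hgr _ hf (q * d)
      change homogeneousComponent _ (expand q f) ∈ T at this
      rw [homogeneousComponent_expand hqpos] at this
      exact this
    obtain ⟨l, hl⟩ := mem_range_expand (hdvd h hhT)
    have hlT : l ∈ T₁ := by
      change expand q l ∈ T
      rwa [hl]
    have hl1 : l.IsHomogeneous 1 := by
      have := homogeneousComponent_expand hqpos l 1
      rw [hl, mul_one, homogeneousComponent_eq_self hh, ← hl] at this
      rw [expand_injective hqpos this]
      exact homogeneousComponent_isHomogeneous _ _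
    have hl0 : l ≠ 0 := by
      rintro rfl
      simp at hl
      exact hh0 hl.symm
    obtain ⟨α, hα⟩ := MvPolynomial.ne_zero_iff.1 hl0
    obtain ⟨i, hi⟩ : ∃ i, α i ≠ 0 := by
      by_contra! hall
      have h0 : α = 0 := by ext i; exact hall i
      subst h0
      exact hα (hl1.coeff_eq_zero (by simp))
    obtain rfl := hl1.eq_single_of_coeff_ne_zero hα hi
    have his : i ∈ s := mem_supported_iff_coeff.1 (hs₁ hlT) _ hα i (by simp)
    obtain ⟨g, hg, hgT⟩ := IH (s.erase i).card (by
        rw [← hn]; exact Finset.card_erase_lt_of_mem his) (s.erase i) rfl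
        (T₁ ⊓ supported k (s.erase i : Set ι)) inf_le_right
        (hT₁.inf_supported i) (hgr₁.inf_supported _)
    let gl := Function.update g i l
    refine ⟨fun j => expand q (gl j), fun j => ?_, ?_⟩
    · have : ∃ d, 0 < d ∧ (gl j).IsHomogeneous d := by
        by_cases h : j = i
        · subst h; exact ⟨1, one_pos, by simpa [gl] using hl1⟩
        · simpa [gl, h] using hg j
      obtain ⟨d, hd, h⟩ := this
      exact ⟨q * d, Nat.mul_pos hqpos hd, isHomogeneous_expand hqpos h⟩
    · have h1 : T₁ = Algebra.adjoin k (gl '' s) := by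
        apply le_antisymm
        · refine (exists_linear_shift hs₁ hT₁ hlT hl1 hα).trans (Algebra.adjoin_le ?_)
          rintro x (rfl | hx)
          · exact Algebra.subset_adjoin ⟨i, his, by simp [gl]⟩
          · rw [hgT] at hx
            refine Algebra.adjoin_mono ?_ hx
            rintro _ ⟨j, hj, rfl⟩
            have hj' := Finset.mem_erase.1 hj
            exact ⟨j, hj'.2, by simp [gl, hj'.1]⟩
        · refine Algebra.adjoin_le ?_
          rintro _ ⟨j, hj, rfl⟩
          by_cases h : j = i
          · subst h; simpa [gl] using hlT
          · have : g j ∈ T₁ ⊓ supported k (s.erase i : Set ι) := by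
              rw [hgT]
              exact Algebra.subset_adjoin ⟨j, by simpa [h] using hj, rfl⟩
            simpa [gl, h] using this.1
      rw [hTT₁, h1, AlgHom.map_adjoin, Set.image_image]
  · refine ⟨fun _ => 0, fun _ => ⟨1, one_pos, isHomogeneous_zero _ _ _⟩, ?_⟩
    have hbot : T = ⊥ := by
      rw [eq_bot_iff]
      intro f hf
      rw [Algebra.mem_bot]
      refine ⟨coeff 0 f, ?_⟩
      ext α
      rw [algebraMap_eq, coeff_C]
      split_ifs with h0
      · rw [h0]
      · by_contra hα
        obtain ⟨i, hi⟩ : ∃ i, α i ≠ 0 := by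
          by_contra! hall
          exact h0 (by ext i; exact (hall i).symm)
        obtain ⟨w, hw, g, hg, hg1, hg2⟩ :=
          exists_isHomogeneous_expChar_pow hs hT hgr hf (Ne.symm hα) hi
        refine hex ⟨w, g, hg, hg1, ?_⟩
        rintro rfl
        simp at hg2
    rw [hbot]
    symm
    rw [eq_bot_iff]
    refine Algebra.adjoin_le ?_
    rintro _ ⟨j, hj, rfl⟩
    exact zero_mem _

section AdaptedBasis

variable {V : Type*} [AddCommGroup V] [Module k V]

/-- Two commuting maps `v ↦ v + l v • w` for which one functional does not vanish on the vector of
the other one are proportional. -/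
theorem parallel_of_commute {l₁ l₂ : Module.Dual k V} {w₁ w₂ : V} (hl₁ : l₁ ≠ 0) (hw₁ : w₁ ≠ 0)
    (hw₂ : w₂ ≠ 0)
    (hcomm : ∀ v, (v + l₁ v • w₁) + l₂ (v + l₁ v • w₁) • w₂ =
      (v + l₂ v • w₂) + l₁ (v + l₂ v • w₂) • w₁)
    (h : l₂ w₁ ≠ 0) : ∃ c d : k, c ≠ 0 ∧ d ≠ 0 ∧ w₂ = c • w₁ ∧ l₂ = d • l₁ := by
  have key : ∀ v, (l₁ v * l₂ w₁) • w₂ = (l₂ v * l₁ w₂) • w₁ := by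
    intro v
    have := hcomm v
    simp only [map_add, map_smul, smul_eq_mul, add_smul] at this
    have h2 : v + l₁ v • w₁ + (l₂ v • w₂ + (l₁ v * l₂ w₁) • w₂) -
      (v + l₂ v • w₂ + (l₁ v • w₁ + (l₂ v * l₁ w₂) • w₁)) = 0 := sub_eq_zero.2 this
    rw [← sub_eq_zero, ← h2]
    abel
  obtain ⟨v, hv⟩ : ∃ v, l₁ v ≠ 0 := by
    by_contra! hall
    exact hl₁ (LinearMap.ext hall)
  have hw : w₂ = ((l₁ v * l₂ w₁)⁻¹ * (l₂ v * l₁ w₂)) • w₁ := by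
    rw [mul_smul, ← key v, smul_smul, inv_mul_cancel₀ (mul_ne_zero hv h), one_smul]
  set c := (l₁ v * l₂ w₁)⁻¹ * (l₂ v * l₁ w₂) with hc
  have hc0 : c ≠ 0 := by
    intro h0
    rw [h0, zero_smul] at hw
    exact hw₂ hw
  have key2 : ∀ x, l₁ x * l₂ w₁ = l₂ x * l₁ w₁ := by
    intro x
    have h1 := key x
    rw [hw, map_smul, smul_smul, smul_eq_mul] at h1
    have h2 := smul_left_injective k hw₁ h1
    apply mul_right_cancel₀ hc0
    rw [h2]
    ring
  have h11 : l₁ w₁ ≠ 0 := by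
    intro h0
    have := key2 v
    rw [h0, mul_zero] at this
    exact mul_ne_zero hv h this
  refine ⟨c, l₂ w₁ / l₁ w₁, hc0, div_ne_zero h h11, hw, ?_⟩
  ext x
  have := key2 x
  simp only [LinearMap.smul_apply, smul_eq_mul]
  field_simp
  rw [← this]
  ring

/-- A basis adapted to a set of commuting pseudo-reflections. -/
theorem exists_adapted_basis [FiniteDimensional k V] {n : ℕ} (hn : Module.finrank k V = n)
    (S : Set (V →ₗ[k] V))
    (hS : ∀ γ ∈ S, ∃ l : Module.Dual k V, ∃ w : V, l ≠ 0 ∧ w ≠ 0 ∧ ∀ v, γ v = v + l v • w)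
    (hcomm : ∀ a ∈ S, ∀ b ∈ S, ∀ v, a (b v) = b (a v)) :
    ∃ (b : Module.Basis (Fin n) k V) (s : Finset (Fin n)), ∀ γ ∈ S,
      (∀ j ∉ s, (∃ χ : k, γ (b j) = χ • b j) ∧ (γ (b j) = b j ∨ ∀ i ≠ j, γ (b i) = b i)) ∧
      (∀ i ∈ s, γ (b i) - b i ∈ Submodule.span k (b '' {j | j ∉ s})) := by
  classical
  choose! l w hl hw hγ using hS
  have par : ∀ σ ∈ S, ∀ τ ∈ S, l τ (w σ) ≠ 0 →
      ∃ c d : k, c ≠ 0 ∧ d ≠ 0 ∧ w τ = c • w σ ∧ l τ = d • l σ := by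
    intro σ hσ τ hτ h
    refine parallel_of_commute (hl σ hσ) (hw σ hσ) (hw τ hτ) (fun v => ?_) h
    rw [← hγ σ hσ v, ← hγ τ hτ v, ← hγ σ hσ, ← hγ τ hτ]
    exact hcomm τ hτ σ hσ v
  let Sd := {γ | γ ∈ S ∧ l γ (w γ) ≠ 0}
  obtain ⟨s₀, hs₀, hspan, hli⟩ := exists_linearIndependent k (w '' Sd)
  have hfin : Finite s₀ := hli.finite
  have : Fintype s₀ := Fintype.ofFinite _
  have hex : ∀ u : s₀, ∃ σ ∈ S, l σ (u : V) ≠ 0 ∧ w σ = u := by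
    intro u
    obtain ⟨σ, hσ, h⟩ := hs₀ u.2
    exact ⟨σ, hσ.1, by rw [← h]; exact hσ.2, h⟩
  choose σ hσS hσl hσw using hex
  have hδ : ∀ u u' : s₀, u ≠ u' → l (σ u) (u' : V) = 0 := by
    intro u u' hne
    by_contra h
    rw [← hσw u'] at h
    obtain ⟨c, d, hc, hd, h1, h2⟩ := par _ (hσS u') _ (hσS u) h
    rw [hσw, hσw] at h1
    have h3 := linearIndependent_iff'.1 hli {u, u'} (fun x => if x = u then 1 else -c) (by
      rw [Finset.sum_pair hne]
      simp [hne.symm, h1]) u (by simp)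
    simp at h3
  let μ : s₀ → Module.Dual k V := fun u => (l (σ u) (u : V))⁻¹ • l (σ u)
  have hμ : ∀ u u' : s₀, μ u (u' : V) = if u = u' then 1 else 0 := by
    intro u u'
    split_ifs with h
    · subst h; simp [μ, hσl]
    · simp [μ, hδ u u' h]
  let P : V →ₗ[k] V := ∑ u, (μ u).smulRight (u : V)
  have hP : ∀ v, P v = ∑ u, μ u v • (u : V) := by intro v; simp [P]
  have hPD : ∀ v, P v ∈ Submodule.span k s₀ := by
    intro v
    rw [hP]
    exact Submodule.sum_mem _ fun u _ => Submodule.smul_mem _ _ (Submodule.subset_span u.2)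
  have hPid : ∀ v ∈ Submodule.span k s₀, P v = v := by
    intro v hv
    induction hv using Submodule.span_induction with
    | mem x hx =>
      rw [hP, Finset.sum_eq_single ⟨x, hx⟩]
      · have := hμ ⟨x, hx⟩ ⟨x, hx⟩
        simp only [if_true] at this
        rw [this, one_smul]
      · intro u _ hu
        have := hμ u ⟨x, hx⟩
        rw [if_neg hu] at this
        simp only at this
        rw [this, zero_smul]
      · simp
    | zero => simp
    | add x y _ _ hx hy => rw [map_add, hx, hy]
    | smul a x _ hx => rw [map_smul, hx]
  have hμP : ∀ u v, μ u (P v) = μ u v := by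
    intro u v
    rw [hP, map_sum]
    simp [hμ]
  have hker : ∀ v, P v = 0 → ∀ u, l (σ u) v = 0 := by
    intro v hv u
    have h1 := hμP u v
    rw [hv, map_zero] at h1
    have h2 : (l (σ u) (u : V))⁻¹ * l (σ u) v = 0 := h1.symm
    exact (mul_eq_zero.1 h2).resolve_left (inv_ne_zero (hσl u))
  have hker' : ∀ v, P v = 0 → ∀ γ ∈ Sd, l γ v = 0 := by
    intro v hv γ hg
    have hwD : w γ ∈ Submodule.span k s₀ := by
      rw [hspan]
      exact Submodule.subset_span ⟨γ, hg, rfl⟩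
    obtain ⟨u, hu⟩ : ∃ u, l (σ u) (w γ) ≠ 0 := by
      by_contra! hall
      have := hPid _ hwD
      rw [hP, Finset.sum_eq_zero] at this
      · exact hw γ hg.1 this.symm
      · intro u _
        simp [μ, hall u]
    obtain ⟨c, d, hc, hd, h1, h2⟩ := par _ hg.1 _ (hσS u) hu
    have := hker v hv u
    rw [h2] at this
    exact (mul_eq_zero.1 this).resolve_left hd
  let Q : Submodule k V := ⨅ γ ∈ S, LinearMap.ker (l γ)
  have hQ : ∀ v, v ∈ Q ↔ ∀ γ ∈ S, l γ v = 0 := by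
    intro v
    simp [Q, Submodule.mem_iInf]
  have hQV : Q ≤ LinearMap.ker P := by
    intro v hv
    rw [LinearMap.mem_ker, hP]
    refine Finset.sum_eq_zero fun u _ => ?_
    simp [μ, (hQ v).1 hv _ (hσS u)]
  obtain ⟨C, hC1, hC2⟩ : ∃ C : Submodule k V, Disjoint Q C ∧ Q ⊔ C = LinearMap.ker P := by
    obtain ⟨C', hC'⟩ := Submodule.exists_isCompl Q
    refine ⟨C' ⊓ LinearMap.ker P, hC'.disjoint.mono_right inf_le_left, ?_⟩
    rw [← sup_inf_assoc_of_le _ hQV, hC'.sup_eq_top, top_inf_eq]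
  let bQ := Module.finBasis k Q
  let bC := Module.finBasis k C
  have hspanQ : Submodule.span k (Set.range fun i => (bQ i : V)) = Q := by
    have := congrArg (Submodule.map Q.subtype) bQ.span_eq
    rw [Submodule.map_span, ← Set.range_comp, Submodule.map_top, Submodule.range_subtype] at this
    exact this
  have hspanC : Submodule.span k (Set.range fun i => (bC i : V)) = C := by
    have := congrArg (Submodule.map C.subtype) bC.span_eq
    rw [Submodule.map_span, ← Set.range_comp, Submodule.map_top, Submodule.range_subtype] at this
    exact this
  have hliQ : LinearIndependent k fun i => (bQ i : V) :=
    bQ.linearIndependent.map' Q.subtype (Submodule.ker_subtype Q)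
  have hliC : LinearIndependent k fun i => (bC i : V) :=
    bC.linearIndependent.map' C.subtype (Submodule.ker_subtype C)
  have hdisj : Disjoint (Submodule.span k s₀) (LinearMap.ker P) := by
    rw [Submodule.disjoint_def]
    intro x hx hx'
    rw [← hPid x hx]
    exact hx'
  have hliQC := hliQ.sum_type hliC (by rw [hspanQ, hspanC]; exact hC1)
  have hspanQC : Submodule.span k (Set.range (Sum.elim (fun i => (bQ i : V)) fun i => (bC i : V)))
      = LinearMap.ker P := by
    rw [Set.Sum.elim_range, Submodule.span_union, hspanQ, hspanC, hC2]
  have hliAll := hli.sum_type hliQC (by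
    rw [hspanQC]
    simpa using hdisj)
  have htop : ⊤ ≤ Submodule.span k (Set.range (Sum.elim (fun u : s₀ => (u : V))
      (Sum.elim (fun i => (bQ i : V)) fun i => (bC i : V)))) := by
    rw [Set.Sum.elim_range, Submodule.span_union, hspanQC]
    intro v _
    have : v = P v + (v - P v) := by abel
    rw [this]
    refine Submodule.add_mem_sup ?_ ?_
    · simpa using hPD v
    · rw [LinearMap.mem_ker, map_sub, hPid _ (hPD v), sub_self]
  let B := Module.Basis.mk hliAll htop
  have e : (s₀ ⊕ (Fin (Module.finrank k Q) ⊕ Fin (Module.finrank k C))) ≃ Fin n :=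
    Fintype.equivFinOfCardEq (by rw [← Module.finrank_eq_card_basis B, hn])
  let b := B.reindex e
  have hb0 : ∀ u : s₀, b (e (Sum.inl u)) = u := by intro u; simp [b, B]
  have hbQ : ∀ i, b (e (Sum.inr (Sum.inl i))) = bQ i := by intro u; simp [b, B]
  have hbC : ∀ i, b (e (Sum.inr (Sum.inr i))) = bC i := by intro u; simp [b, B]
  have hbker : ∀ x, P (b (e (Sum.inr x))) = 0 := by
    intro x
    change b (e (Sum.inr x)) ∈ LinearMap.ker P
    rw [← hC2]
    rcases x with i | i
    · rw [hbQ]; exact Submodule.mem_sup_left (bQ i).2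
    · rw [hbC]; exact Submodule.mem_sup_right (bC i).2
  refine ⟨b, Finset.univ.filter fun j => ∃ i, j = e (Sum.inr (Sum.inr i)), fun γ hg => ⟨?_, ?_⟩⟩
  · intro j hj
    obtain ⟨x, rfl⟩ := e.surjective j
    rcases x with u | i | i
    · by_cases h0 : l γ (u : V) = 0
      · have : γ (b (e (Sum.inl u))) = b (e (Sum.inl u)) := by
          rw [hb0, hγ γ hg, h0]; simp
        exact ⟨⟨1, by rw [this, one_smul]⟩, Or.inl this⟩
      · rw [← hσw u] at h0
        obtain ⟨c, d, hc, hd, h1, h2⟩ := par _ (hσS u) _ hg h0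
        rw [hσw] at h1
        refine ⟨⟨1 + l γ u * c, ?_⟩, Or.inr fun i hi => ?_⟩
        · rw [hb0, hγ γ hg, h1, smul_smul, add_smul, one_smul]
        · obtain ⟨y, rfl⟩ := e.surjective i
          rw [hγ γ hg, h2]
          have : l (σ u) (b (e y)) = 0 := by
            rcases y with u' | y
            · rw [hb0]
              apply hδ
              rintro rfl
              exact hi rfl
            · exact hker _ (hbker y) u
          simp [this]
    · have : γ (b (e (Sum.inr (Sum.inl i)))) = b (e (Sum.inr (Sum.inl i))) := by
        rw [hbQ, hγ γ hg, (hQ _).1 (bQ i).2 γ hg]; simp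
      exact ⟨⟨1, by rw [this, one_smul]⟩, Or.inl this⟩
    · simp at hj
  · intro j hj
    obtain ⟨-, i, rfl⟩ := Finset.mem_filter.1 hj
    rw [hγ γ hg, add_sub_cancel_left]
    by_cases hd : l γ (w γ) = 0
    · apply Submodule.smul_mem
      have hwQ : w γ ∈ Q := by
        rw [hQ]
        intro τ hτ
        by_contra h
        obtain ⟨c, d, hc, hd', h1, h2⟩ := par _ hg _ hτ h
        rw [h2] at h
        simp [hd] at h
      rw [← hspanQ] at hwQ
      refine Submodule.span_mono ?_ hwQ
      rintro _ ⟨x, rfl⟩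
      exact ⟨e (Sum.inr (Sum.inl x)), by simp, hbQ x⟩
    · rw [hker' _ (hbker _) γ ⟨hg, hd⟩, zero_smul]
      exact zero_mem _

end AdaptedBasis

theorem isHomogeneous_algHom {σ : MvPolynomial ι k →ₐ[k] MvPolynomial ι k}
    (hσ : ∀ i, (σ (X i)).IsHomogeneous 1) {f : MvPolynomial ι k} {d : ℕ} (hf : f.IsHomogeneous d) :
    (σ f).IsHomogeneous d := by
  have h : σ = aeval fun i => σ (X i) := by
    refine MvPolynomial.algHom_ext fun j => ?_
    simp
  rw [h]
  have := hf.aeval (fun i => σ (X i)) hσ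
  simpa using this

theorem homogeneousComponent_algHom {σ : MvPolynomial ι k →ₐ[k] MvPolynomial ι k}
    (hσ : ∀ i, (σ (X i)).IsHomogeneous 1) (f : MvPolynomial ι k) (d : ℕ) :
    homogeneousComponent d (σ f) = σ (homogeneousComponent d f) := by
  induction f using MvPolynomial.induction_on' with
  | monomial α c =>
    have h1 : (monomial α c).IsHomogeneous α.degree := isHomogeneous_monomial c rfl
    rw [homogeneousComponent_of_mem h1, homogeneousComponent_of_mem (isHomogeneous_algHom hσ h1)]
    split_ifs <;> simp
  | add p q hp hq => simp only [map_add, hp, hq]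

theorem homogeneousComponent_mul_of_isHomogeneous {x : MvPolynomial ι k} {e : ℕ}
    (hx : x.IsHomogeneous e) (y : MvPolynomial ι k) (m : ℕ) :
    homogeneousComponent (e + m) (x * y) = x * homogeneousComponent m y := by
  induction y using MvPolynomial.induction_on' with
  | monomial α c =>
    have h1 : (monomial α c).IsHomogeneous α.degree := isHomogeneous_monomial c rfl
    rw [homogeneousComponent_of_mem h1, homogeneousComponent_of_mem (hx.mul h1)]
    by_cases h : m = α.degree
    · simp [h]
    · rw [if_neg h, if_neg (by omega), mul_zero]
  | add p q hp hq => simp only [map_add, mul_add, hp, hq]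

theorem isGradedSubalgebra_adjoin {t : Set (MvPolynomial ι k)}
    (ht : ∀ f ∈ t, ∃ d, f.IsHomogeneous d) : IsGradedSubalgebra (Algebra.adjoin k t) := by
  intro f hf d
  rw [← Subalgebra.mem_toSubmodule, Algebra.adjoin_eq_span] at hf ⊢
  induction hf using Submodule.span_induction with
  | mem x hx =>
    have : ∃ e, x.IsHomogeneous e := by
      induction hx using Submonoid.closure_induction with
      | mem x hx => exact ht x hx
      | one => exact ⟨0, isHomogeneous_one ι k⟩
      | mul x y _ _ hx hy =>
        obtain ⟨a, ha⟩ := hx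
        obtain ⟨b, hb⟩ := hy
        exact ⟨a + b, ha.mul hb⟩
    obtain ⟨e, he⟩ := this
    rw [homogeneousComponent_of_mem he]
    split_ifs
    · exact Submodule.subset_span hx
    · exact zero_mem _
  | zero => simp
  | add x y _ _ hx hy => rw [map_add]; exact add_mem hx hy
  | smul a x _ hx => rw [map_smul]; exact Submodule.smul_mem _ _ hx

theorem taylorAt_eq_C_of_mem_span {s : Finset ι} {i : ι} (hi : i ∈ s) {y : MvPolynomial ι k}
    (hy : y ∈ Submodule.span k ((X : ι → MvPolynomial ι k) '' {j | j ∉ s})) :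
    taylorAt i y = Polynomial.C y := by
  induction hy using Submodule.span_induction with
  | mem x hx =>
    obtain ⟨j, hj, rfl⟩ := hx
    exact taylorAt_X_of_ne (by rintro rfl; exact hj hi)
  | zero => simp
  | add x y _ _ hx hy => rw [map_add, hx, hy, map_add]
  | smul a x _ hx => rw [map_smul, hx, Polynomial.smul_C]

theorem coeff_taylorAt_algHom {i : ι} {σ : MvPolynomial ι k →ₐ[k] MvPolynomial ι k}
    (h : ∀ j, taylorAt i (σ (X j)) = (taylorAt (k := k) i (X j)).map (σ : _ →+* _)) (f : MvPolynomial ι k)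
    (a : ℕ) : (taylorAt i (σ f)).coeff a = σ ((taylorAt i f).coeff a) := by
  have : (taylorAt i).comp σ = (Polynomial.mapAlgHom σ).comp (taylorAt i) := by
    refine MvPolynomial.algHom_ext fun j => ?_
    simpa using h j
  have h2 := DFunLike.congr_fun this f
  simp only [AlgHom.comp_apply] at h2
  rw [h2]
  simp

theorem coeff_scale {j : ι} {c : k} {σ : MvPolynomial ι k →ₐ[k] MvPolynomial ι k}
    (hj : σ (X j) = c • X j) (hi : ∀ i ≠ j, σ (X i) = X i) (f : MvPolynomial ι k) (α : ι →₀ ℕ) :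
    coeff α (σ f) = c ^ α j * coeff α f := by
  induction f using MvPolynomial.induction_on' with
  | monomial β b =>
    have h1 : monomial β b = monomial (β.erase j) b * (X j) ^ (β j) := by
      rw [X_pow_eq_monomial, monomial_mul, mul_one, Finsupp.erase_add_single]
    have h2 : σ (monomial (β.erase j) b) = monomial (β.erase j) b := by
      rw [monomial_eq, map_mul, Finsupp.prod, map_prod]
      congr 1
      · exact σ.commutes b
      · refine Finset.prod_congr rfl fun l hl => ?_
        rw [map_pow, hi]
        rintro rfl
        simp at hl
    have h3 : σ (monomial β b) = c ^ β j • monomial β b := by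
      conv_lhs => rw [h1, map_mul, h2, map_pow, hj, smul_pow, mul_smul_comm, ← h1]
    rw [h3, coeff_smul, coeff_monomial, smul_eq_mul]
    split_ifs with h
    · rw [h]
    · simp
  | add p q hp hq => rw [map_add, coeff_add, hp, hq, coeff_add, mul_add]

/-- Setting the variables outside `s` to zero. -/
noncomputable def restrictVars (s : Finset ι) : MvPolynomial ι k →ₐ[k] MvPolynomial ι k :=
  aeval fun i => if i ∈ s then X i else 0

theorem coeff_restrictVars (s : Finset ι) (f : MvPolynomial ι k) (α : ι →₀ ℕ) :
    coeff α (restrictVars s f) = if ∀ j ∉ s, α j = 0 then coeff α f else 0 := by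
  induction f using MvPolynomial.induction_on' with
  | monomial β b =>
    have h1 : restrictVars s (monomial β b) = if ∀ j ∉ s, β j = 0 then monomial β b else 0 := by
      rw [restrictVars, aeval_monomial]
      split_ifs with h
      · rw [monomial_eq, Finsupp.prod, Finsupp.prod]
        congr 1
        refine Finset.prod_congr rfl fun j hj => ?_
        rw [if_pos]
        by_contra hjs
        exact Finsupp.mem_support_iff.1 hj (h j hjs)
      · push Not at h
        obtain ⟨j, hj, hj0⟩ := h
        rw [Finsupp.prod, Finset.prod_eq_zero (Finsupp.mem_support_iff.2 hj0), mul_zero]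
        simp [hj, hj0]
    rw [h1]
    by_cases h : β = α
    · subst h; split_ifs <;> simp
    · split_ifs <;> simp [coeff_monomial, h]
  | add p q hp hq =>
    rw [map_add, coeff_add, hp, hq, coeff_add]
    split_ifs <;> simp

/-- Homogeneous generators of a ring of invariants in adapted coordinates, given a Reynolds-type
operator `π`. -/
theorem exists_generators_of_adapted {s : Finset ι}
    (H : Set (MvPolynomial ι k →ₐ[k] MvPolynomial ι k))
    (hlin : ∀ σ ∈ H, ∀ i, (σ (X i)).IsHomogeneous 1)
    (hA : ∀ σ ∈ H, ∀ j ∉ s, (∃ χ : k, σ (X j) = χ • X j) ∧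
      (σ (X j) = X j ∨ ∀ i ≠ j, σ (X i) = X i))
    (hB : ∀ σ ∈ H, ∀ i ∈ s,
      σ (X i) - X i ∈ Submodule.span k ((X : ι → MvPolynomial ι k) '' {j | j ∉ s}))
    (R : Subalgebra k (MvPolynomial ι k)) (hR : ∀ f, f ∈ R ↔ ∀ σ ∈ H, σ f = f)
    (hpow : ∀ j ∉ s, ∃ e, 0 < e ∧ (X j ^ e : MvPolynomial ι k) ∈ R)
    (π : MvPolynomial ι k →+ MvPolynomial ι k) (hπR : ∀ a, π a ∈ R)
    (hπ : ∀ r ∈ R, ∀ a, π (r * a) = r * π a) (hπ1 : π 1 = 1) :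
    ∃ f : ι → MvPolynomial ι k, (∀ i, f i ∈ R) ∧ (∀ i, ∃ d, 0 < d ∧ (f i).IsHomogeneous d) ∧
      Algebra.adjoin k (Set.range f) = R := by
  classical
  have hgrR : IsGradedSubalgebra R := by
    intro f hf d
    rw [hR] at hf ⊢
    intro σ hσ
    rw [← homogeneousComponent_algHom (hlin σ hσ), hf σ hσ]
  have hstR : HasseStable s R := by
    intro i hi f hf a
    rw [hR] at hf ⊢
    intro σ hσ
    rw [← coeff_taylorAt_algHom, hf σ hσ]
    intro j
    by_cases hj : j ∈ s
    · obtain ⟨y, hy⟩ : ∃ y, y = σ (X j) - X j := ⟨_, rfl⟩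
      have h1 := hB σ hσ j hj
      rw [← hy] at h1
      have h2 : σ (X j) = X j + y := by rw [hy]; ring
      rw [h2, map_add, taylorAt_eq_C_of_mem_span hi h1]
      by_cases hji : j = i
      · subst hji
        rw [taylorAt_X_self]
        simp only [Polynomial.map_add, Polynomial.map_C, Polynomial.map_X, RingHom.coe_coe, h2]
        rw [map_add]
        ring
      · rw [taylorAt_X_of_ne hji]
        simp [h2]
    · obtain ⟨χ, hχ⟩ := (hA σ hσ j hj).1
      have hji : j ≠ i := by rintro rfl; exact hj hi
      rw [hχ, map_smul, taylorAt_X_of_ne hji]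
      simp [hχ, Polynomial.smul_C]
  have hexp : ∀ f ∈ R, ∀ α, coeff α f ≠ 0 → ∀ j ∉ s, (X j ^ α j : MvPolynomial ι k) ∈ R := by
    intro f hf α hα j hj
    rw [hR] at hf ⊢
    intro σ hσ
    obtain ⟨⟨χ, hχ⟩, h | h⟩ := hA σ hσ j hj
    · rw [map_pow, h]
    · have h1 := coeff_scale hχ h f α
      rw [hf σ hσ] at h1
      have h2 : χ ^ α j = 1 := by
        apply mul_right_cancel₀ hα
        rw [← h1, one_mul]
      rw [map_pow, hχ, smul_pow, h2, one_smul]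
  have hmin : ∀ j ∉ s, ∃ e, 0 < e ∧ (X j ^ e : MvPolynomial ι k) ∈ R ∧
      ∀ m, 0 < m → (X j ^ m : MvPolynomial ι k) ∈ R → e ≤ m := fun j hj =>
    ⟨Nat.find (hpow j hj), (Nat.find_spec (hpow j hj)).1, (Nat.find_spec (hpow j hj)).2,
      fun m h1 h2 => Nat.find_min' (hpow j hj) ⟨h1, h2⟩⟩
  choose! e hepos heR hemin using hmin
  let ε : MvPolynomial ι k →ₐ[k] MvPolynomial ι k := restrictVars s
  have hεlin : ∀ i, (ε (X i)).IsHomogeneous 1 := by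
    intro i
    simp only [ε, restrictVars, aeval_X]
    split_ifs
    · exact isHomogeneous_X k i
    · exact isHomogeneous_zero _ _ _
  have hεtay : ∀ i ∈ s, ∀ (f : MvPolynomial ι k) a,
      (taylorAt i (ε f)).coeff a = ε ((taylorAt i f).coeff a) := by
    intro i hi f a
    refine coeff_taylorAt_algHom (fun j => ?_) f a
    by_cases hji : j = i
    · subst hji
      simp [ε, restrictVars, hi, taylorAt_X_self]
    · rw [taylorAt_X_of_ne hji]
      by_cases hj : j ∈ s
      · simp [ε, restrictVars, hj, taylorAt_X_of_ne hji]
      · simp [ε, restrictVars, hj]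
  obtain ⟨g, hg, hgT⟩ := exists_generators_of_hasseStable s (R.map ε) (by
      rintro _ ⟨f, -, rfl⟩
      refine mem_supported_iff_coeff.2 fun α hα i hi => ?_
      change coeff α (restrictVars s f) ≠ 0 at hα
      rw [coeff_restrictVars] at hα
      by_contra his
      split_ifs at hα with h
      · exact hi (h i his)
      · exact hα rfl) (by
      rintro i hi _ ⟨f, hf, rfl⟩ a
      refine ⟨(taylorAt i f).coeff a, hstR i hi f hf a, ?_⟩
      exact (hεtay i hi f a).symm) (by
      rintro _ ⟨f, hf, rfl⟩ d
      exact ⟨homogeneousComponent d f, hgrR f hf d, (homogeneousComponent_algHom hεlin f d).symm⟩)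
  have hlift : ∀ i ∈ s, ∃ F ∈ R, (∃ d, 0 < d ∧ F.IsHomogeneous d) ∧ ε F = g i := by
    intro i hi
    have : g i ∈ R.map ε := by
      rw [hgT]
      exact Algebra.subset_adjoin ⟨i, hi, rfl⟩
    obtain ⟨F, hF, hFg⟩ := this
    obtain ⟨d, hd, hgd⟩ := hg i
    refine ⟨homogeneousComponent d F, hgrR F hF d,
      ⟨d, hd, homogeneousComponent_isHomogeneous _ _⟩, ?_⟩
    change ε F = g i at hFg
    rw [← homogeneousComponent_algHom hεlin, hFg, homogeneousComponent_eq_self hgd]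
  choose! F hFR hFd hFg using hlift
  let f : ι → MvPolynomial ι k := fun i => if i ∈ s then F i else X i ^ e i
  have hfR : ∀ i, f i ∈ R := by
    intro i
    by_cases hi : i ∈ s
    · simpa [f, hi] using hFR i hi
    · simpa [f, hi] using heR i hi
  have hfd : ∀ i, ∃ d, 0 < d ∧ (f i).IsHomogeneous d := by
    intro i
    by_cases hi : i ∈ s
    · simpa [f, hi] using hFd i hi
    · refine ⟨e i, hepos i hi, ?_⟩
      simpa [f, hi] using isHomogeneous_X_pow (R := k) i (e i)
  have hBle : Algebra.adjoin k (Set.range f) ≤ R := by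
    refine Algebra.adjoin_le ?_
    rintro _ ⟨i, rfl⟩
    exact hfR i
  have hBgr : IsGradedSubalgebra (Algebra.adjoin k (Set.range f)) := by
    apply isGradedSubalgebra_adjoin
    rintro _ ⟨i, rfl⟩
    obtain ⟨d, -, h⟩ := hfd i
    exact ⟨d, h⟩
  have hπid : ∀ r ∈ R, π r = r := by
    intro r hr
    have := hπ r hr 1
    rwa [hπ1, mul_one] at this
  have main : ∀ d, ∀ h ∈ R, h.IsHomogeneous d → h ∈ Algebra.adjoin k (Set.range f) := by
    intro d
    induction d using Nat.strong_induction_on with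
    | _ d IH =>
    intro h hhR hhd
    obtain ⟨P, hP, hPε⟩ : ∃ P ∈ Algebra.adjoin k (Set.range f), ε P = ε h := by
      have h1 : ε h ∈ R.map ε := ⟨h, hhR, rfl⟩
      have h2 : g '' s = ε '' (F '' s) := by
        rw [Set.image_image]
        exact Set.image_congr fun i hi => (hFg i hi).symm
      rw [hgT, h2, ← AlgHom.map_adjoin] at h1
      obtain ⟨P, hP, hPε⟩ := h1
      refine ⟨P, Algebra.adjoin_mono ?_ hP, hPε⟩
      rintro _ ⟨i, hi, rfl⟩
      have : i ∈ s := hi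
      exact ⟨i, by simp [f, this]⟩
    let Q := homogeneousComponent d P
    have hQ : Q ∈ Algebra.adjoin k (Set.range f) := hBgr P hP d
    have hQε : ε Q = ε h := by
      rw [← homogeneousComponent_algHom hεlin, hPε, homogeneousComponent_algHom hεlin,
        homogeneousComponent_eq_self hhd]
    have hdR : h - Q ∈ R := sub_mem hhR (hBle hQ)
    have hdd : (h - Q).IsHomogeneous d := hhd.sub (homogeneousComponent_isHomogeneous _ _)
    suffices h - Q ∈ Algebra.adjoin k (Set.range f) by
      have h3 := add_mem this hQ
      rwa [sub_add_cancel] at h3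
    have hdε : ε (h - Q) = 0 := by rw [map_sub, hQε, sub_self]
    obtain ⟨u, hu⟩ : ∃ u, u = h - Q := ⟨_, rfl⟩
    rw [← hu] at hdR hdd hdε ⊢
    have hsum : u = ∑ α ∈ u.support, homogeneousComponent d (π (monomial α (coeff α u))) := by
      rw [← map_sum, ← map_sum, ← u.as_sum, hπid u hdR, homogeneousComponent_eq_self hdd]
    rw [hsum]
    refine sum_mem fun α hα => ?_
    have hα' := mem_support_iff.1 hα
    obtain ⟨j, hj, hαj⟩ : ∃ j ∉ s, α j ≠ 0 := by
      by_contra! hall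
      have h4 := coeff_restrictVars s u α
      rw [if_pos hall] at h4
      change coeff α (ε u) = _ at h4
      rw [hdε] at h4
      exact hα' (by rw [← h4, coeff_zero])
    have hle : e j ≤ α j := hemin j hj _ (Nat.pos_of_ne_zero hαj) (hexp u hdR α hα' j hj)
    have hdeg : α.degree = d := by
      by_contra hne
      exact hα' (hdd.coeff_eq_zero hne)
    have hαd : α j ≤ d := by
      rw [← hdeg]
      exact Finsupp.le_degree j α
    have hmon : monomial α (coeff α u) =
        X j ^ e j * monomial (α - Finsupp.single j (e j)) (coeff α u) := by
      rw [X_pow_eq_monomial, monomial_mul, one_mul, add_tsub_cancel_of_le]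
      simpa using hle
    have hsplit : d = e j + (d - e j) := by omega
    rw [hmon, hπ _ (heR j hj), hsplit,
      homogeneousComponent_mul_of_isHomogeneous (isHomogeneous_X_pow j (e j))]
    refine mul_mem (Algebra.subset_adjoin ⟨j, by simp [f, hj]⟩) ?_
    have hej := hepos j hj
    exact IH (d - e j) (by omega) _ (hgrR _ (hπR _) _) (homogeneousComponent_isHomogeneous _ _)
  refine ⟨f, hfR, hfd, le_antisymm hBle fun h hh => ?_⟩
  rw [← sum_homogeneousComponent h]
  exact sum_mem fun d _ => main d _ (hgrR h hh d) (homogeneousComponent_isHomogeneous _ _)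

theorem galAct_X (M : Matrix.GeneralLinearGroup ι k) (i : ι) :
    galAct M (X i) =
      ∑ j, (((M⁻¹ : Matrix.GeneralLinearGroup ι k) : Matrix ι ι k) i j) • X j := by
  simp [galAct]

theorem galAct_linearCombination (M : Matrix.GeneralLinearGroup ι k) (v : ι → k) :
    galAct M (Fintype.linearCombination k X v) = Fintype.linearCombination k X
      (Matrix.vecMul v ((M⁻¹ : Matrix.GeneralLinearGroup ι k) : Matrix ι ι k)) := by
  simp only [Fintype.linearCombination_apply, map_sum, map_smul, galAct_X, Matrix.vecMul,
    dotProduct, Finset.smul_sum, Finset.sum_smul, smul_smul]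
  exact Finset.sum_comm

theorem galAct_X_isHomogeneous (M : Matrix.GeneralLinearGroup ι k) (i : ι) :
    (galAct M (X i)).IsHomogeneous 1 := by
  rw [galAct_X]
  exact Submodule.sum_mem (homogeneousSubmodule ι k 1) fun j _ =>
    Submodule.smul_mem _ _ (isHomogeneous_X k j)

theorem galAct_one : galAct (1 : Matrix.GeneralLinearGroup ι k) = AlgHom.id k _ := by
  refine MvPolynomial.algHom_ext fun i => ?_
  rw [galAct_X]
  simp [Matrix.one_apply]

theorem galAct_mul (M N : Matrix.GeneralLinearGroup ι k) :
    galAct (M * N) = (galAct M).comp (galAct N) := by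
  refine MvPolynomial.algHom_ext fun i => ?_
  have h : (X i : MvPolynomial ι k) = Fintype.linearCombination k X (Pi.single i (1 : k)) := by
    rw [Fintype.linearCombination_apply_single, one_smul]
  rw [AlgHom.comp_apply, h, galAct_linearCombination, galAct_linearCombination,
    galAct_linearCombination, Matrix.vecMul_vecMul, mul_inv_rev, Matrix.GeneralLinearGroup.coe_mul]

theorem galAct_mul_apply (M N : Matrix.GeneralLinearGroup ι k) (p : MvPolynomial ι k) :
    galAct (M * N) p = galAct M (galAct N p) := by
  rw [galAct_mul]; rfl

theorem galAct_one_apply (p : MvPolynomial ι k) :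
    galAct (1 : Matrix.GeneralLinearGroup ι k) p = p := by
  rw [galAct_one]; rfl

theorem galAct_injective (M : Matrix.GeneralLinearGroup ι k) : Function.Injective (galAct M) := by
  intro p q h
  have := congrArg (galAct M⁻¹) h
  rwa [← galAct_mul_apply, ← galAct_mul_apply, inv_mul_cancel, galAct_one_apply,
    galAct_one_apply] at this

/-- The action of `G` on polynomials by ring automorphisms. -/
@[reducible] noncomputable def galAction (G : Subgroup (Matrix.GeneralLinearGroup ι k)) :
    MulSemiringAction ↥G (MvPolynomial ι k) where
  smul σ p := galAct (σ : Matrix.GeneralLinearGroup ι k) p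
  one_smul p := galAct_one_apply p
  mul_smul σ τ p := galAct_mul_apply _ _ p
  smul_zero σ := map_zero (galAct _)
  smul_add σ := map_add (galAct _)
  smul_one σ := map_one (galAct _)
  smul_mul σ := map_mul (galAct _)

theorem isIntegral_invariants (G : Subgroup (Matrix.GeneralLinearGroup ι k)) [Finite ↥G] :
    Algebra.IsIntegral ↥(invariants G) (MvPolynomial ι k) := by
  let := galAction G
  have : Algebra.IsInvariant ↥(invariants G) (MvPolynomial ι k) ↥G :=
    ⟨fun b hb => ⟨⟨b, fun σ hσ => hb ⟨σ, hσ⟩⟩, rfl⟩⟩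
  exact Algebra.IsInvariant.isIntegral ↥(invariants G) (MvPolynomial ι k) ↥G

theorem algebraicIndependent_of_adjoin_eq_invariants
    (G : Subgroup (Matrix.GeneralLinearGroup ι k)) [Finite ↥G] (f : ι → MvPolynomial ι k)
    (hf : Algebra.adjoin k (Set.range f) = invariants G) : AlgebraicIndependent k f := by
  have h1 := isIntegral_invariants G
  rw [← hf] at h1
  have h2 : Algebra.IsAlgebraic ↥(Algebra.adjoin k (Set.range f)) (MvPolynomial ι k) := inferInstance
  have := Algebra.IsAlgebraic.isTranscendenceBasis_of_lift_le_trdeg_of_finite (R := k) f (by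
    rw [MvPolynomial.trdeg_of_isDomain, Cardinal.lift_lift, Cardinal.lift_umax])
  exact this.1

theorem IsPseudoReflection.exists_vecMul {M : Matrix.GeneralLinearGroup ι k}
    (hM : IsPseudoReflection M) : ∃ l : Module.Dual k (ι → k), ∃ w : ι → k, l ≠ 0 ∧ w ≠ 0 ∧
      ∀ v, Matrix.vecMul v ((M⁻¹ : Matrix.GeneralLinearGroup ι k) : Matrix ι ι k) =
        v + l v • w := by
  set N : Matrix ι ι k := ((M⁻¹ : Matrix.GeneralLinearGroup ι k) : Matrix ι ι k) with hN
  have hMN : N * (M : Matrix ι ι k) = 1 := by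
    rw [hN, ← Matrix.GeneralLinearGroup.coe_mul, inv_mul_cancel]; rfl
  have hr : (N - 1).rank = 1 := by
    have h1 : N - 1 = ((-M⁻¹ : Matrix.GeneralLinearGroup ι k) : Matrix ι ι k) *
        ((M : Matrix ι ι k) - 1) := by
      rw [Units.val_neg, ← hN, neg_mul, mul_sub, hMN]; simp
    rw [h1, Matrix.rank_mul_eq_right_of_isUnit_det]
    · exact hM
    · exact Matrix.isUnits_det_units _
  rw [← Matrix.rank_transpose] at hr
  obtain ⟨⟨w, v₀, hv₀⟩, hw0, hw⟩ := finrank_eq_one_iff'.1 hr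
  have hw0' : w ≠ 0 := fun h => hw0 (by ext1; exact h)
  obtain ⟨i, hi⟩ := Function.ne_iff.1 hw0'
  replace hi : w i ≠ 0 := hi
  let l : Module.Dual k (ι → k) := (w i)⁻¹ • (LinearMap.proj i ∘ₗ ((N - 1).transpose).mulVecLin)
  have hl : ∀ v, Matrix.vecMul v N = v + l v • w := by
    intro v
    obtain ⟨c, hc⟩ := hw ⟨_, ⟨v, rfl⟩⟩
    have hc' : c • w = (N - 1).transpose.mulVec v := congrArg Subtype.val hc
    have hlv : l v = c := by
      simp only [l, LinearMap.smul_apply, LinearMap.comp_apply, Matrix.mulVecLin_apply,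
        LinearMap.proj_apply, ← hc', Pi.smul_apply, smul_eq_mul]
      field_simp
    rw [hlv, hc', Matrix.mulVec_transpose, Matrix.vecMul_sub, Matrix.vecMul_one]
    abel
  refine ⟨l, w, ?_, hw0', hl⟩
  intro h0
  apply hw0'
  have h1 := hl v₀
  have h2 : Matrix.vecMul v₀ (N - 1) = w := by
    rw [← Matrix.mulVec_transpose]; exact hv₀
  rw [h0] at h1
  rw [← h2, Matrix.vecMul_sub, Matrix.vecMul_one, h1]
  simp

theorem mem_invariants_iff_of_closure {G : Subgroup (Matrix.GeneralLinearGroup ι k)}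
    {S : Set (Matrix.GeneralLinearGroup ι k)} (hS : Subgroup.closure S = G)
    {p : MvPolynomial ι k} : p ∈ invariants G ↔ ∀ σ ∈ S, galAct σ p = p := by
  subst hS
  refine ⟨fun h σ hσ => h σ (Subgroup.subset_closure hσ), fun h σ hσ => ?_⟩
  induction hσ using Subgroup.closure_induction with
  | mem x hx => exact h x hx
  | one => exact galAct_one_apply p
  | mul x y _ _ hx hy => rw [galAct_mul_apply, hy, hx]
  | inv x _ hx =>
    apply galAct_injective x
    rw [← galAct_mul_apply, mul_inv_cancel, galAct_one_apply, hx]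

theorem galAct_pow_eq_smul {σ : Matrix.GeneralLinearGroup ι k} {p : MvPolynomial ι k} {χ : k}
    (h : galAct σ p = χ • p) (m : ℕ) : galAct (σ ^ m) p = χ ^ m • p := by
  induction m with
  | zero => simp [galAct_one_apply]
  | succ m ih => rw [pow_succ, galAct_mul_apply, h, map_smul, ih, smul_smul, pow_succ']

theorem coregular_of_closure_of_DSP {n : ℕ}
    (G : Subgroup (Matrix.GeneralLinearGroup (Fin n) k)) [Finite ↥G]
    (habelian : ∀ a ∈ G, ∀ b ∈ G, a * b = b * a)
    (hG : Subgroup.closure {σ | σ ∈ G ∧ IsPseudoReflection σ} = G) (hD : DSP G) :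
    ∃ f : Fin n → MvPolynomial (Fin n) k,
        (∀ i, f i ∈ invariants G) ∧
        (∀ i, ∃ d, 0 < d ∧ (f i).IsHomogeneous d) ∧
        AlgebraicIndependent k f ∧
        Algebra.adjoin k (Set.range f) = invariants G := by
  classical
  let vm : Matrix.GeneralLinearGroup (Fin n) k → ((Fin n → k) →ₗ[k] (Fin n → k)) := fun σ =>
    Matrix.vecMulLinear ((σ⁻¹ : Matrix.GeneralLinearGroup (Fin n) k) : Matrix (Fin n) (Fin n) k)
  obtain ⟨b, s, hb⟩ := exists_adapted_basis (k := k) (V := Fin n → k) (n := n) (by simp)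
    (vm '' {σ | σ ∈ G ∧ IsPseudoReflection σ})
    (by
      rintro _ ⟨σ, ⟨-, hσ⟩, rfl⟩
      exact hσ.exists_vecMul)
    (by
      rintro _ ⟨σ, ⟨hσ, -⟩, rfl⟩ _ ⟨τ, ⟨hτ, -⟩, rfl⟩ v
      simp only [vm, Matrix.vecMulLinear_apply, Matrix.vecMul_vecMul,
        ← Matrix.GeneralLinearGroup.coe_mul, ← mul_inv_rev, habelian σ hσ τ hτ])
  let lin : (Fin n → k) →ₗ[k] MvPolynomial (Fin n) k := Fintype.linearCombination k X
  let lin' : (Fin n → k) →ₗ[k] MvPolynomial (Fin n) k := b.constr k X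
  have hlin : ∀ i, lin (Pi.single i 1) = X i := fun i => by
    simp [lin]
  have hlin' : ∀ i, lin' (b i) = X i := fun i => by simp [lin']
  let ψ : MvPolynomial (Fin n) k →ₐ[k] MvPolynomial (Fin n) k := aeval fun j => lin (b j)
  let ψ' : MvPolynomial (Fin n) k →ₐ[k] MvPolynomial (Fin n) k :=
    aeval fun i => lin' (Pi.single i 1)
  have hψ'lin : ∀ v, ψ' (lin v) = lin' v := by
    intro v
    have : ψ'.toLinearMap ∘ₗ lin = lin' := by
      refine (Pi.basisFun k (Fin n)).ext fun i => ?_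
      simp only [LinearMap.comp_apply, Pi.basisFun_apply, hlin, AlgHom.toLinearMap_apply, ψ', aeval_X]
    exact LinearMap.congr_fun this v
  have hψlin' : ∀ v, ψ (lin' v) = lin v := by
    intro v
    have : ψ.toLinearMap ∘ₗ lin' = lin := by
      refine b.ext fun i => ?_
      simp only [LinearMap.comp_apply, hlin', AlgHom.toLinearMap_apply, ψ, aeval_X]
    exact LinearMap.congr_fun this v
  have h1 : ψ.comp ψ' = AlgHom.id k _ := by
    refine MvPolynomial.algHom_ext fun i => ?_
    rw [AlgHom.comp_apply, ← hlin, hψ'lin, hψlin']; rfl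
  have h2 : ψ'.comp ψ = AlgHom.id k _ := by
    refine MvPolynomial.algHom_ext fun i => ?_
    rw [AlgHom.comp_apply, ← hlin', hψlin', hψ'lin]; rfl
  have h1' : ∀ p, ψ (ψ' p) = p := fun p => DFunLike.congr_fun h1 p
  have h2' : ∀ p, ψ' (ψ p) = p := fun p => DFunLike.congr_fun h2 p
  have hlinhom : ∀ v, (lin v).IsHomogeneous 1 := fun v => by
    simp only [lin, Fintype.linearCombination_apply]
    exact Submodule.sum_mem (homogeneousSubmodule _ k 1) fun j _ =>
      Submodule.smul_mem _ _ (isHomogeneous_X k j)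
  have hlinhom' : ∀ v, (lin' v).IsHomogeneous 1 := fun v => by
    simp only [lin', Module.Basis.constr_apply_fintype]
    exact Submodule.sum_mem (homogeneousSubmodule _ k 1) fun j _ =>
      Submodule.smul_mem _ _ (isHomogeneous_X k j)
  have hgal : ∀ σ v, galAct σ (lin v) = lin (vm σ v) := fun σ v => galAct_linearCombination σ v
  have hconj : ∀ σ v, ψ' (galAct σ (ψ (lin' v))) = lin' (vm σ v) := fun σ v => by
    rw [hψlin', hgal, hψ'lin]
  let H : Set (MvPolynomial (Fin n) k →ₐ[k] MvPolynomial (Fin n) k) :=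
    (fun σ => ψ'.comp ((galAct σ).comp ψ)) '' {σ | σ ∈ G ∧ IsPseudoReflection σ}
  obtain ⟨π, hπs, -⟩ := hD
  obtain ⟨a, ha⟩ := hπs 1
  obtain ⟨f, hfR, hfh, hfa⟩ := exists_generators_of_adapted (s := s) H
    (by
      rintro _ ⟨σ, -, rfl⟩ i
      simp only [AlgHom.comp_apply]
      rw [← hlin' i, hconj]
      exact hlinhom' _)
    (by
      rintro _ ⟨σ, hσ, rfl⟩ j hj
      simp only [AlgHom.comp_apply]
      obtain ⟨⟨χ, hχ⟩, h⟩ := (hb _ ⟨σ, hσ, rfl⟩).1 j hj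
      simp only [← hlin', hconj]
      refine ⟨⟨χ, by rw [hχ, map_smul]⟩, h.imp (fun h => by rw [h]) (fun h i hi => by rw [h i hi])⟩)
    (by
      rintro _ ⟨σ, hσ, rfl⟩ i hi
      simp only [AlgHom.comp_apply]
      have h := Submodule.mem_map_of_mem (f := lin') ((hb _ ⟨σ, hσ, rfl⟩).2 i hi)
      rw [Submodule.map_span, ← Set.image_comp, map_sub] at h
      rw [← hlin' i, hconj]
      convert h using 3
      exact (hlin' _).symm)
    ((invariants G).comap ψ)
    (by
      intro p
      rw [Subalgebra.mem_comap, mem_invariants_iff_of_closure hG]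
      simp only [H, Set.forall_mem_image, AlgHom.comp_apply]
      refine forall₂_congr fun σ hσ => ⟨fun h => by rw [h, h2'], fun h => ?_⟩
      rw [← h1' (galAct σ (ψ p)), h])
    (by
      intro j hj
      refine ⟨Nat.card G, Nat.card_pos, ?_⟩
      rw [Subalgebra.mem_comap, mem_invariants_iff_of_closure hG]
      intro σ hσ
      obtain ⟨⟨χ, hχ⟩, -⟩ := (hb _ ⟨σ, hσ, rfl⟩).1 j hj
      have h3 : galAct σ (ψ (X j)) = χ • ψ (X j) := by
        rw [← hlin', hψlin', hgal, hχ, map_smul]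
      have h4 := galAct_pow_eq_smul h3 (Nat.card G)
      have h5 : σ ^ Nat.card G = 1 := by
        have := pow_card_eq_one' (G := G) (x := ⟨σ, hσ.1⟩)
        exact congrArg Subtype.val this
      rw [h5, galAct_one_apply] at h4
      rw [map_pow, map_pow, h3]
      have h6 : χ ^ Nat.card G = 1 := by
        have h7 : (1 : k) • ψ (X j) = χ ^ Nat.card G • ψ (X j) := by rw [one_smul]; exact h4
        refine (smul_left_injective k ?_ h7).symm
        intro h0
        have := h2' (X j)
        rw [h0, map_zero] at this
        exact X_ne_zero j this.symm
      rw [_root_.smul_pow, h6, one_smul])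
    { toFun := fun x => ψ' (π (a * ψ x))
      map_zero' := by simp
      map_add' := fun x y => by simp [mul_add] }
    (by
      intro x
      rw [Subalgebra.mem_comap]
      simp only [AddMonoidHom.coe_mk, ZeroHom.coe_mk, h1']
      exact Subtype.prop _)
    (by
      intro r hr x
      simp only [AddMonoidHom.coe_mk, ZeroHom.coe_mk]
      have h3 : a * ψ (r * x) = (⟨ψ r, hr⟩ : ↥(invariants G)) • (a * ψ x) := by
        rw [Subalgebra.smul_def, smul_eq_mul, map_mul]; ring
      rw [h3, map_smul, smul_eq_mul, Subalgebra.coe_mul, map_mul, h2'])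
    (by simp [ha])
  have hadj : Algebra.adjoin k (Set.range fun i => ψ (f i)) = invariants G := by
    have h3 : (Set.range fun i => ψ (f i)) = ψ '' Set.range f := by rw [← Set.range_comp]; rfl
    rw [h3, ← AlgHom.map_adjoin, hfa]
    ext p
    simp only [Subalgebra.mem_map, Subalgebra.mem_comap]
    exact ⟨fun ⟨q, hq, h⟩ => h ▸ hq, fun h => ⟨ψ' p, by rwa [h1'], h1' p⟩⟩
  refine ⟨fun i => ψ (f i), hfR, fun i => ?_,
    algebraicIndependent_of_adjoin_eq_invariants G _ hadj, hadj⟩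
  obtain ⟨d, hd, h⟩ := hfh i
  refine ⟨d, hd, isHomogeneous_algHom (fun i => ?_) h⟩
  simp only [ψ, aeval_X]
  exact hlinhom _

section LocalRegularity

open RingTheory.Sequence IsLocalRing Pointwise

variable {A : Type*} [CommRing A] [IsLocalRing A] [IsNoetherianRing A]

theorem eq_maximalIdeal_of_avoids_minimalPrimes {J : Ideal A} {f z : A}
    (hJ : J ≤ maximalIdeal A) (hf : f ∈ maximalIdeal A)
    (h : ∀ P : Ideal A, P.IsPrime → J ≤ P → f ∈ P → P = maximalIdeal A)
    (hz : ∀ P ∈ J.minimalPrimes, z ∈ P → P = maximalIdeal A)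
    (P : Ideal A) (hP : P.IsPrime) (hJP : J ≤ P) (hzP : z ∈ P) : P = maximalIdeal A := by
  by_contra hne
  have hlt : P < maximalIdeal A := lt_of_le_of_ne (le_maximalIdeal hP.ne_top) hne
  refine hne (hz P ?_ hzP)
  have := Ideal.mem_minimalPrimes_span_of_mem_minimalPrimes_span_insert hlt f (J : Set A)
    ?_ (J : Set A) hJP ?_
  · rwa [Ideal.span_eq] at this
  · refine ⟨⟨inferInstance, ?_⟩, ?_⟩
    · rw [Ideal.span_le, Set.insert_subset_iff]
      exact ⟨hf, hJ⟩
    · rintro Q ⟨hQ, hQJ⟩ -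
      rw [Ideal.span_le, Set.insert_subset_iff] at hQJ
      exact (h Q hQ hQJ.2 hQJ.1).ge
  · exact fun x hx => Ideal.le_radical (Ideal.subset_span (Set.mem_insert_of_mem _ hx))

theorem exists_avoids_minimalPrimes (J J' : Ideal A) :
    ∃ z ∈ maximalIdeal A, (∀ P ∈ J.minimalPrimes, z ∈ P → P = maximalIdeal A) ∧
      ∀ P ∈ J'.minimalPrimes, z ∈ P → P = maximalIdeal A := by
  by_contra! hcon
  let S : Set (Ideal A) := {P | P ∈ J.minimalPrimes ∪ J'.minimalPrimes ∧ P ≠ maximalIdeal A}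
  have hS : S.Finite := ((J.finite_minimalPrimes_of_isNoetherianRing).union
    (J'.finite_minimalPrimes_of_isNoetherianRing)).subset fun P hP => hP.1
  have hprime : ∀ P ∈ S, P.IsPrime := by
    rintro P ⟨hP | hP, -⟩ <;> exact hP.1.1
  obtain ⟨P, hP, hle⟩ := ((maximalIdeal A).subset_union_prime_finite hS (f := id) 0 0
    fun P h _ _ => hprime P h).1 (by
      intro z hz
      simp only [Set.mem_iUnion]
      by_cases h : ∀ P ∈ J.minimalPrimes, z ∈ P → P = maximalIdeal A
      · obtain ⟨P, hP, hzP, hne⟩ := hcon z hz h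
        exact ⟨P, ⟨Or.inr hP, hne⟩, hzP⟩
      · push Not at h
        obtain ⟨P, hP, hzP, hne⟩ := h
        exact ⟨P, ⟨Or.inl hP, hne⟩, hzP⟩)
  exact hP.2 (le_antisymm (le_maximalIdeal (hprime P hP).ne_top) hle)

theorem isSMulRegular_of_forall_prime {N : Type*} [AddCommGroup N] [Module A N] {x u : A}
    (hx : IsSMulRegular N x) (hxm : x ∈ maximalIdeal A)
    (h : ∀ P : Ideal A, P.IsPrime → Module.annihilator A N ≤ P → u ∈ P → P = maximalIdeal A) :
    IsSMulRegular N u := by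
  by_contra hu
  have hU := biUnion_associatedPrimes_eq_compl_regular A N
  have hu' : u ∈ ⋃ p ∈ associatedPrimes A N, (p : Set A) := by rw [hU]; exact hu
  simp only [Set.mem_iUnion] at hu'
  obtain ⟨P, hP, huP⟩ := hu'
  have hPm := h P hP.1 (Submodule.annihilator_top (R := A) (M := N) ▸ hP.annihilator_le) huP
  have hxU : x ∈ ⋃ p ∈ associatedPrimes A N, (p : Set A) :=
    Set.mem_iUnion₂_of_mem hP (by rw [hPm]; exact hxm)
  rw [hU] at hxU
  exact hxU hx

/-- In a Noetherian local ring, if some sequence of length `n` is regular on a finite module and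
cuts its support down to the closed point, then so is every sequence of length `n` which does. -/
theorem isWeaklyRegular_of_forall_prime (n : ℕ) {M : Type*} [AddCommGroup M] [Module A M]
    [Module.Finite A M] (xs fs : List A) (hxn : xs.length = n) (hfn : fs.length = n)
    (hxm : ∀ x ∈ xs, x ∈ maximalIdeal A) (hfm : ∀ f ∈ fs, f ∈ maximalIdeal A)
    (hx : IsWeaklyRegular M xs)
    (hxP : ∀ P : Ideal A, P.IsPrime → Module.annihilator A M ≤ P → (∀ x ∈ xs, x ∈ P) →
      P = maximalIdeal A)
    (hfP : ∀ P : Ideal A, P.IsPrime → Module.annihilator A M ≤ P → (∀ x ∈ fs, x ∈ P) →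
      P = maximalIdeal A) : IsWeaklyRegular M fs := by
  induction n generalizing M xs fs with
  | zero =>
    rw [List.length_eq_zero_iff] at hfn
    subst hfn
    exact .nil A M
  | succ n ih =>
    rcases subsingleton_or_nontrivial M with hM | hM
    · rw [isWeaklyRegular_iff_Fin]
      intro i a b _
      have : Subsingleton (M ⧸ (Ideal.ofList (fs.take i) • ⊤ : Submodule A M)) :=
        (Submodule.mkQ_surjective _).subsingleton
      exact Subsingleton.elim _ _
    have hann : Module.annihilator A M ≤ maximalIdeal A := le_maximalIdeal (by
      rw [Ne, Ideal.eq_top_iff_one, Module.mem_annihilator]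
      obtain ⟨m, hm⟩ := exists_ne (0 : M)
      exact fun h => hm (by simpa using h m))
    obtain ⟨xs, x, rfl⟩ : ∃ l a, xs = l ++ [a] :=
      (List.eq_nil_or_concat' xs).resolve_left (by rintro rfl; simp at hxn)
    obtain ⟨fs, f, rfl⟩ : ∃ l a, fs = l ++ [a] :=
      (List.eq_nil_or_concat' fs).resolve_left (by rintro rfl; simp at hfn)
    simp only [List.length_append, List.length_singleton, Nat.add_right_cancel_iff] at hxn hfn
    simp only [List.mem_append, List.mem_singleton, or_imp, forall_and, forall_eq]
      at hxm hfm hxP hfP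
    have hofList : ∀ (l : List A) (P : Ideal A), Ideal.ofList l ≤ P ↔ ∀ x ∈ l, x ∈ P :=
      fun l P => Ideal.span_le
    obtain ⟨z, hzm, hz1, hz2⟩ := exists_avoids_minimalPrimes
      (Module.annihilator A M ⊔ Ideal.ofList xs) (Module.annihilator A M ⊔ Ideal.ofList fs)
    have hzx := eq_maximalIdeal_of_avoids_minimalPrimes (f := x)
      (sup_le hann ((hofList _ _).2 hxm.1)) hxm.2
      (fun P hP hJ hxP' => hxP P hP (le_sup_left.trans hJ)
        ⟨(hofList _ _).1 (le_sup_right.trans hJ), hxP'⟩) hz1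
    have hzf := eq_maximalIdeal_of_avoids_minimalPrimes (f := f)
      (sup_le hann ((hofList _ _).2 hfm.1)) hfm.2
      (fun P hP hJ hxP' => hfP P hP (le_sup_left.trans hJ)
        ⟨(hofList _ _).1 (le_sup_right.trans hJ), hxP'⟩) hz2
    have hquot : ∀ l : List A, Module.annihilator A M ⊔ Ideal.ofList l ≤
        Module.annihilator A (M ⧸ (Ideal.ofList l • ⊤ : Submodule A M)) := by
      intro l
      refine sup_le (LinearMap.annihilator_le_of_surjective _ (Submodule.mkQ_surjective _)) ?_
      intro a ha
      rw [Module.mem_annihilator]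
      intro m
      obtain ⟨m, rfl⟩ := Submodule.mkQ_surjective _ m
      rw [← map_smul, Submodule.mkQ_apply, Submodule.Quotient.mk_eq_zero]
      exact Submodule.smul_mem_smul ha trivial
    have hquotz : Module.annihilator A M ⊔ Ideal.span {z} ≤
        Module.annihilator A (QuotSMulTop z M) := by
      refine sup_le (LinearMap.annihilator_le_of_surjective _ (Submodule.mkQ_surjective _)) ?_
      rw [Ideal.span_singleton_le_iff_mem, Module.mem_annihilator]
      intro m
      obtain ⟨m, rfl⟩ := Submodule.mkQ_surjective _ m
      rw [← map_smul, Submodule.mkQ_apply, Submodule.Quotient.mk_eq_zero]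
      exact Submodule.smul_mem_pointwise_smul m z _ trivial
    rw [isWeaklyRegular_append_iff, isWeaklyRegular_singleton_iff] at hx ⊢
    have hxz : IsWeaklyRegular M (xs ++ [z]) := by
      rw [isWeaklyRegular_append_iff, isWeaklyRegular_singleton_iff]
      exact ⟨hx.1, isSMulRegular_of_forall_prime hx.2 hxm.2
        fun P hP hPa => hzx P hP ((hquot xs).trans hPa)⟩
    have hzxs := isWeaklyRegular_of_perm_of_subset_maximalIdeal hxz
      (List.perm_append_singleton z xs) (by
        simp only [List.mem_append, List.mem_singleton, or_imp, forall_and, forall_eq]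
        exact ⟨hxm.1, hzm⟩)
    rw [isWeaklyRegular_cons_iff] at hzxs
    have hfz : IsWeaklyRegular (QuotSMulTop z M) fs := by
      refine ih xs fs hxn hfn hxm.1 hfm.1 hzxs.2 ?_ ?_
      · intro P hP hPa hPx
        have := hquotz.trans hPa
        exact hzx P hP (sup_le (le_sup_left.trans this) ((hofList _ _).2 hPx))
          ((Ideal.span_singleton_le_iff_mem _).1 (le_sup_right.trans this))
      · intro P hP hPa hPx
        have := hquotz.trans hPa
        exact hzf P hP (sup_le (le_sup_left.trans this) ((hofList _ _).2 hPx))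
          ((Ideal.span_singleton_le_iff_mem _).1 (le_sup_right.trans this))
    have hfsz := isWeaklyRegular_of_perm_of_subset_maximalIdeal (hfz.cons hzxs.1)
      (List.perm_append_singleton z fs).symm (by
        simp only [List.mem_cons, or_imp, forall_and, forall_eq]
        exact ⟨hzm, hfm.1⟩)
    rw [isWeaklyRegular_append_iff, isWeaklyRegular_singleton_iff] at hfsz
    refine ⟨hfsz.1, isSMulRegular_of_forall_prime hfsz.2 hzm fun P hP hPa hfP' => ?_⟩
    have := (hquot fs).trans hPa
    exact hfP P hP (le_sup_left.trans this) ⟨(hofList _ _).1 (le_sup_right.trans this), hfP'⟩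

end LocalRegularity

section GradedRegularity

open RingTheory.Sequence IsLocalRing

theorem isWeaklyRegular_ofFn_iff {R : Type*} [CommRing R] {n : ℕ} (f : Fin n → R) :
    IsWeaklyRegular R (List.ofFn f) ↔ ∀ i g, f i * g ∈ Ideal.span (f '' Set.Iio i) →
      g ∈ Ideal.span (f '' Set.Iio i) := by
  have hspan : ∀ i : Fin n, (Ideal.ofList ((List.ofFn f).take i) • ⊤ : Submodule R R) =
      Ideal.span (f '' Set.Iio i) := by
    intro i
    rw [smul_eq_mul, Ideal.mul_top, Ideal.ofList]
    congr 1
    ext r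
    simp only [List.mem_take_iff_getElem, Set.mem_ofPred_eq, Set.mem_image, Set.mem_Iio]
    constructor
    · rintro ⟨j, hj, rfl⟩
      simp only [List.length_ofFn, lt_min_iff] at hj
      exact ⟨⟨j, hj.2⟩, hj.1, by simp⟩
    · rintro ⟨j, hj, rfl⟩
      exact ⟨j, by simpa using hj, by simp⟩
  rw [isWeaklyRegular_iff]
  simp only [List.length_ofFn, List.getElem_ofFn]
  rw [← Fin.forall_iff (p := fun i : Fin n => IsSMulRegular
    (R ⧸ (Ideal.ofList ((List.ofFn f).take i) • ⊤ : Submodule R R)) (f i))]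
  refine forall_congr' fun i => ?_
  rw [isSMulRegular_quotient_iff_mem_of_smul_mem, hspan]
  rfl

theorem homogeneousComponent_mul_eq_zero_of_lt {x : MvPolynomial ι k} {e m : ℕ}
    (hx : x.IsHomogeneous e) (y : MvPolynomial ι k) (hm : m < e) :
    homogeneousComponent m (x * y) = 0 := by
  induction y using MvPolynomial.induction_on' with
  | monomial α c =>
    have h1 : (monomial α c).IsHomogeneous α.degree := isHomogeneous_monomial c rfl
    rw [homogeneousComponent_of_mem (hx.mul h1), if_neg (by omega)]
  | add p q hp hq => simp only [map_add, mul_add, hp, hq, add_zero]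

theorem homogeneousComponent_mem_span {t : Set (MvPolynomial ι k)}
    (ht : ∀ f ∈ t, ∃ d, f.IsHomogeneous d) {p : MvPolynomial ι k} (hp : p ∈ Ideal.span t)
    (d : ℕ) : homogeneousComponent d p ∈ Ideal.span t := by
  let := MvPolynomial.gradedAlgebra (σ := ι) (R := k)
  exact homogeneousComponent_mem_of_mem
    (Ideal.homogeneous_span (homogeneousSubmodule ι k) t fun x hx => ht x hx) hp d

theorem mem_of_mul_mem_span_of_constantCoeff_ne_zero {t : Set (MvPolynomial ι k)}
    (ht : ∀ f ∈ t, ∃ d, f.IsHomogeneous d) {s g : MvPolynomial ι k} (hs : constantCoeff s ≠ 0)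
    (h : s * g ∈ Ideal.span t) : g ∈ Ideal.span t := by
  have key : ∀ d, homogeneousComponent d g ∈ Ideal.span t := by
    intro d
    induction d using Nat.strong_induction_on with
    | _ d ih =>
      have h1 := homogeneousComponent_mem_span ht h d
      have h2 : s * g = ∑ b ∈ Finset.range (max g.totalDegree d + 1),
          homogeneousComponent b g * s := by
        rw [← Finset.sum_mul, mul_comm]
        congr 1
        conv_lhs => rw [← sum_homogeneousComponent g]
        refine Finset.sum_subset (Finset.range_mono (by omega)) fun b _ hb => ?_
        exact homogeneousComponent_eq_zero _ _ (by simpa using hb)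
      rw [h2, map_sum] at h1
      rw [← Finset.add_sum_erase _ _ (show d ∈ Finset.range (max g.totalDegree d + 1) by simp)]
        at h1
      have h3 : homogeneousComponent d (homogeneousComponent d g * s) =
          homogeneousComponent d g * C (constantCoeff s) := by
        have := homogeneousComponent_mul_of_isHomogeneous
          (homogeneousComponent_isHomogeneous d g) s 0
        rw [add_zero, homogeneousComponent_zero] at this
        exact this
      have h4 : ∑ b ∈ (Finset.range (max g.totalDegree d + 1)).erase d,
          homogeneousComponent d (homogeneousComponent b g * s) ∈ Ideal.span t := by
        refine Ideal.sum_mem _ fun b hb => ?_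
        rcases lt_or_gt_of_ne (Finset.ne_of_mem_erase hb) with hlt | hlt
        · have := homogeneousComponent_mul_of_isHomogeneous
            (homogeneousComponent_isHomogeneous b g) s (d - b)
          rw [Nat.add_sub_cancel' hlt.le] at this
          rw [this]
          exact Ideal.mul_mem_right _ _ (ih b hlt)
        · rw [homogeneousComponent_mul_eq_zero_of_lt (homogeneousComponent_isHomogeneous b g) s hlt]
          exact Ideal.zero_mem _
      have h5 := (Ideal.add_mem_iff_left _ h4).1 h1
      rw [h3] at h5
      have h6 := Ideal.mul_mem_right (C (constantCoeff s)⁻¹) _ h5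
      rwa [mul_assoc, ← C_mul, mul_inv_cancel₀ hs, C_1, mul_one] at h6
  rw [← sum_homogeneousComponent g]
  exact Ideal.sum_mem _ fun d _ => key d

/-- A system of `n` homogeneous elements of positive degree whose ideal contains a power of each
variable is a regular sequence. -/
theorem mem_span_of_mul_mem_span {n : ℕ} {f : Fin n → MvPolynomial (Fin n) k}
    (hf : ∀ i, ∃ d, 0 < d ∧ (f i).IsHomogeneous d)
    (hpow : ∀ i, ∃ N, X i ^ N ∈ Ideal.span (Set.range f)) (i : Fin n)
    (g : MvPolynomial (Fin n) k) (h : f i * g ∈ Ideal.span (f '' Set.Iio i)) :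
    g ∈ Ideal.span (f '' Set.Iio i) := by
  let m : Ideal (MvPolynomial (Fin n) k) := RingHom.ker (constantCoeff (σ := Fin n) (R := k))
  have hmp : m.IsPrime := RingHom.ker_isPrime _
  have hmX : m = Ideal.span (Set.range X) := by
    apply le_antisymm
    · intro p hp
      rw [← Set.image_univ, mem_ideal_span_X_image]
      intro α hα
      by_contra! hc
      have : α = 0 := by ext i; exact hc i trivial
      subst this
      rw [mem_support_iff] at hα
      exact hα hp
    · rw [Ideal.span_le]
      rintro _ ⟨i, rfl⟩
      simp [m, RingHom.mem_ker]
  have hfm : ∀ i, f i ∈ m := fun i => by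
    obtain ⟨d, hd, h⟩ := hf i
    rw [RingHom.mem_ker, constantCoeff_eq]
    exact h.coeff_eq_zero (by simp; omega)
  let L := Localization.AtPrime m
  let al := algebraMap (MvPolynomial (Fin n) k) L
  have hmax : maximalIdeal L = Ideal.map al m := (Localization.AtPrime.map_eq_maximalIdeal).symm
  have hmem : ∀ p ∈ m, al p ∈ maximalIdeal L := fun p hp => by
    rw [hmax]; exact Ideal.mem_map_of_mem _ hp
  have hXP : ∀ P : Ideal L, P.IsPrime → (∀ i, al (X i) ∈ P) → P = maximalIdeal L := by
    intro P hP hX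
    refine le_antisymm (le_maximalIdeal hP.ne_top) ?_
    rw [hmax, Ideal.map_le_iff_le_comap]
    refine hmX.le.trans ?_
    rw [Ideal.span_le]
    rintro _ ⟨i, rfl⟩
    exact hX i
  have hlist : ∀ u : Fin n → MvPolynomial (Fin n) k,
      (List.ofFn u).map al = List.ofFn (fun i => al (u i)) := fun u => by
    rw [List.map_ofFn]; rfl
  have hXreg : IsWeaklyRegular L (List.ofFn fun i : Fin n => al (X i)) := by
    rw [← hlist]
    refine IsWeaklyRegular.of_isLocalization L m.primeCompl ?_
    rw [isWeaklyRegular_ofFn_iff]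
    intro i g hg
    rw [mem_ideal_span_X_image] at hg ⊢
    intro α hα
    obtain ⟨j, hj, hne⟩ := hg (Finsupp.single i 1 + α) (by
      rw [mem_support_iff] at hα ⊢
      rwa [coeff_X_mul])
    refine ⟨j, hj, ?_⟩
    have hji : i ≠ j := (ne_of_lt hj).symm
    simpa [Finsupp.single_apply, hji] using hne
  have hfreg : IsWeaklyRegular L (List.ofFn fun i => al (f i)) := by
    refine isWeaklyRegular_of_forall_prime n _ _ (List.length_ofFn) (List.length_ofFn)
      ?_ ?_ hXreg ?_ ?_
    · simp only [List.forall_mem_ofFn_iff]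
      exact fun i => hmem _ (by simp [m, RingHom.mem_ker])
    · simp only [List.forall_mem_ofFn_iff]
      exact fun i => hmem _ (hfm i)
    · simp only [List.forall_mem_ofFn_iff]
      exact fun P hP _ h => hXP P hP h
    · simp only [List.forall_mem_ofFn_iff]
      refine fun P hP _ h => hXP P hP fun i => ?_
      obtain ⟨N, hN⟩ := hpow i
      have h1 : Ideal.span (Set.range f) ≤ P.comap al := by
        rw [Ideal.span_le]
        rintro _ ⟨i, rfl⟩
        exact h i
      have h2 := h1 hN
      rw [Ideal.mem_comap, map_pow] at h2
      exact hP.mem_of_pow_mem _ h2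
  rw [isWeaklyRegular_ofFn_iff] at hfreg
  have himg : (fun i => al (f i)) '' Set.Iio i = al '' (f '' Set.Iio i) := by
    rw [← Set.image_comp]; rfl
  have h1 := hfreg i (al g) (by
    rw [himg, ← Ideal.map_span, ← map_mul]
    exact Ideal.mem_map_of_mem _ h)
  rw [himg, ← Ideal.map_span,
    IsLocalization.algebraMap_mem_map_algebraMap_iff m.primeCompl] at h1
  obtain ⟨s, hs, hsg⟩ := h1
  refine mem_of_mul_mem_span_of_constantCoeff_ne_zero ?_ hs hsg
  rintro _ ⟨j, -, rfl⟩
  obtain ⟨d, -, h⟩ := hf j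
  exact ⟨d, h⟩

end GradedRegularity

theorem sub_C_mem_span_of_mem_adjoin {κ : Type*} {f : κ → MvPolynomial ι k}
    (hf : ∀ i, constantCoeff (f i) = 0) {p : MvPolynomial ι k}
    (hp : p ∈ Algebra.adjoin k (Set.range f)) :
    p - C (constantCoeff p) ∈ Ideal.span (Set.range f) := by
  induction hp using Algebra.adjoin_induction with
  | mem x hx =>
    obtain ⟨i, rfl⟩ := hx
    rw [hf, C_0, sub_zero]
    exact Ideal.subset_span ⟨i, rfl⟩
  | algebraMap r => simp [algebraMap_eq]
  | add x y _ _ hx hy =>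
    rw [map_add, C_add, add_sub_add_comm]
    exact Ideal.add_mem _ hx hy
  | mul x y _ _ hx hy =>
    have : x * y - C (constantCoeff (x * y)) = (x - C (constantCoeff x)) * y +
        C (constantCoeff x) * (y - C (constantCoeff y)) := by
      rw [map_mul, C_mul]; ring
    rw [this]
    exact Ideal.add_mem _ (Ideal.mul_mem_right _ _ hx) (Ideal.mul_mem_left _ _ hy)

theorem exists_X_pow_mem_span (G : Subgroup (Matrix.GeneralLinearGroup ι k)) [Finite ↥G]
    {κ : Type*} {f : κ → MvPolynomial ι k} (hf : ∀ i, ∃ d, 0 < d ∧ (f i).IsHomogeneous d)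
    (hadj : Algebra.adjoin k (Set.range f) = invariants G) (i : ι) :
    ∃ N, (X i : MvPolynomial ι k) ^ N ∈ Ideal.span (Set.range f) := by
  have hf0 : ∀ i, constantCoeff (f i) = 0 := fun i => by
    obtain ⟨d, hd, h⟩ := hf i
    rw [constantCoeff_eq]
    exact h.coeff_eq_zero (by simp; omega)
  have hint := isIntegral_invariants G
  obtain ⟨p, hpm, hp⟩ := hint.isIntegral (X i : MvPolynomial ι k)
  let ε : ↥(invariants G) →+* k := (constantCoeff (σ := ι) (R := k)).comp (invariants G).val.toRingHom
  let mk := Ideal.Quotient.mk (Ideal.span (Set.range f))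
  have hε : mk.comp (algebraMap ↥(invariants G) (MvPolynomial ι k)) = (mk.comp C).comp ε := by
    ext r
    simp only [RingHom.comp_apply]
    rw [Ideal.Quotient.mk_eq_mk_iff_sub_mem]
    exact sub_C_mem_span_of_mem_adjoin hf0 (by rw [hadj]; exact r.2)
  have h1 : mk (Polynomial.aeval (X i) (p.map ε)) = 0 := by
    have h2 := congrArg mk hp
    rw [map_zero, Polynomial.hom_eval₂, hε, ← Polynomial.eval₂_map, ← Polynomial.hom_eval₂] at h2
    exact h2
  rw [Ideal.Quotient.eq_zero_iff_mem] at h1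
  set q := p.map ε with hq
  have hqm : q.Monic := hpm.map ε
  have h2 := homogeneousComponent_mem_span (t := Set.range f) (by
    rintro _ ⟨j, rfl⟩
    obtain ⟨d, -, h⟩ := hf j
    exact ⟨d, h⟩) h1 q.natDegree
  refine ⟨q.natDegree, ?_⟩
  rw [Polynomial.aeval_eq_sum_range, map_sum,
    Finset.sum_eq_single q.natDegree, map_smul,
    homogeneousComponent_of_mem (isHomogeneous_X_pow i _), if_pos rfl,
    Polynomial.coeff_natDegree, hqm.leadingCoeff, one_smul] at h2
  · exact h2
  · intro b _ hb
    rw [map_smul, homogeneousComponent_of_mem (isHomogeneous_X_pow i _), if_neg hb.symm, smul_zero]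
  · simp

theorem aeval_mem_span_image {κ : Type*} (f : κ → MvPolynomial ι k) (s : Set κ)
    {r : MvPolynomial κ k} (hr : r ∈ Ideal.span (X '' s)) :
    aeval f r ∈ Ideal.span (f '' s) := by
  have := Ideal.mem_map_of_mem (aeval f : MvPolynomial κ k →ₐ[k] MvPolynomial ι k) hr
  rw [Ideal.map_span, ← Set.image_comp] at this
  convert this using 3
  simp

/-- A regular sequence is quasi-regular: relations modulo the sequence lift. -/
theorem eq_zero_of_sum_aeval_mul_eq_zero {n : ℕ} {f : Fin n → MvPolynomial ι k}
    (hreg : ∀ i g, f i * g ∈ Ideal.span (f '' Set.Iio i) → g ∈ Ideal.span (f '' Set.Iio i))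
    {J : Type*} {e : J → MvPolynomial ι k} {T : Finset J}
    (hind : ∀ c : J → k, ∑ j ∈ T, C (c j) * e j ∈ Ideal.span (Set.range f) → ∀ j ∈ T, c j = 0)
    (r : J → MvPolynomial (Fin n) k) (hr : ∑ j ∈ T, aeval f (r j) * e j = 0) :
    ∀ j ∈ T, r j = 0 := by
  have key : ∀ m ≤ n, ∀ r : J → MvPolynomial (Fin n) k,
      ∑ j ∈ T, aeval f (r j) * e j ∈ Ideal.span (f '' {i | (i : ℕ) < n - m}) →
      ∀ j ∈ T, r j ∈ Ideal.span (X '' {i : Fin n | (i : ℕ) < n - m}) := by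
    intro m hm
    induction m with
    | zero =>
      intro r hr j hj
      have huniv : {i : Fin n | (i : ℕ) < n - 0} = Set.univ := by ext i; simp
      rw [huniv, Set.image_univ] at hr ⊢
      have hconst : ∀ q : MvPolynomial (Fin n) k,
          q - C (constantCoeff q) ∈ Ideal.span (Set.range X) := fun q =>
        sub_C_mem_span_of_mem_adjoin (f := (X : Fin n → MvPolynomial (Fin n) k)) (fun i => by simp) (by
          rw [adjoin_range_X]; trivial)
      have h1 := hind (fun j => constantCoeff (r j)) (by
        rw [← Ideal.add_mem_iff_right _ (a := ∑ j ∈ T, aeval f (r j - C (constantCoeff (r j))) * e j)]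
        · rw [← Finset.sum_add_distrib]
          convert hr using 2 with j
          rw [map_sub, aeval_C, algebraMap_eq]; ring
        · refine Ideal.sum_mem _ fun j _ => Ideal.mul_mem_right _ _ ?_
          rw [← Set.image_univ]
          refine aeval_mem_span_image _ _ ?_
          rw [Set.image_univ]
          exact hconst _) j hj
      have h2 := hconst (r j)
      rwa [h1, C_0, sub_zero] at h2
    | succ m ih =>
      replace ih := ih (by omega)
      set i : Fin n := ⟨n - (m + 1), by omega⟩ with hi
      have hI : {j : Fin n | (j : ℕ) < n - (m + 1)} = Set.Iio i := by
        ext j; simp [hi, Fin.lt_def]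
      have hI' : {j : Fin n | (j : ℕ) < n - m} = insert i (Set.Iio i) := by
        ext j
        simp only [Set.mem_ofPred_eq, Set.mem_insert_iff, Set.mem_Iio, Fin.lt_def, Fin.ext_iff, hi]
        omega
      rw [hI]
      rw [hI'] at ih
      have hdeg : ∀ (D : ℕ) (r : J → MvPolynomial (Fin n) k),
          (∀ j ∈ T, ∀ α ∈ (r j).support, α.degree < D) →
          ∑ j ∈ T, aeval f (r j) * e j ∈ Ideal.span (f '' Set.Iio i) →
          ∀ j ∈ T, r j ∈ Ideal.span (X '' Set.Iio i) := by
        intro D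
        induction D with
        | zero =>
          intro r hD _ j hj
          have : r j = 0 := by
            rw [← support_eq_empty, Finset.eq_empty_iff_forall_notMem]
            exact fun α hα => absurd (hD j hj α hα) (by omega)
          rw [this]
          exact Ideal.zero_mem _
        | succ D ihD =>
          intro r hD hr
          have h1 := ih r (Ideal.span_mono (Set.image_mono (Set.subset_insert _ _)) hr)
          have h2 : ∀ j ∈ T, (r j).modMonomial (Finsupp.single i 1) ∈
              Ideal.span (X '' Set.Iio i) := by
            intro j hj
            have h3 := h1 j hj
            rw [mem_ideal_span_X_image] at h3 ⊢
            intro α hα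
            rw [mem_support_iff] at hα
            have hle : ¬ Finsupp.single i 1 ≤ α := fun hle =>
              hα (coeff_modMonomial_of_le _ hle)
            rw [coeff_modMonomial_of_not_le _ hle, ← mem_support_iff] at hα
            obtain ⟨l, hl | hl, hne⟩ := h3 α hα
            · subst hl
              exact absurd (Finsupp.single_le_iff.2 (by omega)) hle
            · exact ⟨l, hl, hne⟩
          have h3 : ∀ j, r j = X i * (r j).divMonomial (Finsupp.single i 1) +
              (r j).modMonomial (Finsupp.single i 1) := fun j =>
            (divMonomial_add_modMonomial_single (r j) i).symm
          have h4 := ihD (fun j => (r j).divMonomial (Finsupp.single i 1)) (by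
              intro j hj α hα
              rw [mem_support_iff, coeff_divMonomial, ← mem_support_iff] at hα
              have := hD j hj _ hα
              rw [map_add, Finsupp.degree_single] at this
              omega) (by
            apply hreg
            rw [← Ideal.add_mem_iff_left _ (b := ∑ j ∈ T,
              aeval f ((r j).modMonomial (Finsupp.single i 1)) * e j)]
            · rw [Finset.mul_sum, ← Finset.sum_add_distrib]
              convert hr using 2 with j
              conv_rhs => rw [h3 j]
              rw [map_add, map_mul, aeval_X]; ring
            · exact Ideal.sum_mem _ fun j hj => Ideal.mul_mem_right _ _
                (aeval_mem_span_image _ _ (h2 j hj)))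
          intro j hj
          rw [h3 j]
          exact Ideal.add_mem _ (Ideal.mul_mem_left _ _ (h4 j hj)) (h2 j hj)
      intro r hr
      refine hdeg (∑ j ∈ T, (r j).totalDegree + 1) r (fun j hj α hα => ?_) hr
      have h5 := le_totalDegree hα
      have h6 := Finset.single_le_sum (f := fun j => (r j).totalDegree) (fun _ _ => Nat.zero_le _) hj
      have h7 : α.degree = α.sum fun _ e => e := rfl
      omega
  intro j hj
  have h := key n le_rfl r (by rw [hr]; exact Ideal.zero_mem _) j hj
  simpa using h

theorem exists_monomial_basis {n : ℕ}
    (G : Subgroup (Matrix.GeneralLinearGroup (Fin n) k)) [Finite ↥G]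
    {f : Fin n → MvPolynomial (Fin n) k} (hf : ∀ i, ∃ d, 0 < d ∧ (f i).IsHomogeneous d)
    (hadj : Algebra.adjoin k (Set.range f) = invariants G) :
    ∃ (B : Set (Fin n →₀ ℕ)) (b : Module.Basis B ↥(invariants G) (MvPolynomial (Fin n) k)),
      0 ∈ B ∧ ∀ β, b β = monomial (β : Fin n →₀ ℕ) (1 : k) := by
  classical
  have hreg := mem_span_of_mul_mem_span hf (exists_X_pow_mem_span G hf hadj)
  set I := Ideal.span (Set.range f) with hI
  have hfh : ∀ p ∈ Set.range f, ∃ d, p.IsHomogeneous d := by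
    rintro _ ⟨i, rfl⟩
    obtain ⟨d, -, h⟩ := hf i
    exact ⟨d, h⟩
  have hfR : ∀ i, f i ∈ invariants G := fun i => hadj ▸ Algebra.subset_adjoin ⟨i, rfl⟩
  let mk := Ideal.Quotient.mkₐ k I
  let e : (Fin n →₀ ℕ) → MvPolynomial (Fin n) k := fun α => monomial α 1
  have h1I : (1 : MvPolynomial (Fin n) k) ∉ I := by
    have hle : I ≤ RingHom.ker (constantCoeff (σ := Fin n) (R := k)) := by
      rw [hI, Ideal.span_le]
      rintro _ ⟨i, rfl⟩
      obtain ⟨d, hd, h⟩ := hf i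
      rw [SetLike.mem_coe, RingHom.mem_ker, constantCoeff_eq]
      exact h.coeff_eq_zero (by simp; omega)
    intro h1
    simpa [RingHom.mem_ker] using hle h1
  obtain ⟨B, -, h0B, hspan, hind⟩ := exists_linearIndepOn_extension (K := k)
    (v := fun α => mk (e α)) (s := {0}) (t := Set.univ)
    (by
      rw [linearIndepOn_singleton_iff]
      intro h
      exact h1I (Ideal.Quotient.eq_zero_iff_mem.1 h)) (Set.subset_univ _)
  have hli : LinearIndependent ↥(invariants G) (fun β : B => e β) := by
    rw [linearIndependent_iff']
    intro T g hg j hj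
    have hrange : ∀ j, ∃ r : MvPolynomial (Fin n) k, aeval f r = (g j : MvPolynomial (Fin n) k) := by
      intro j
      have h1 : (g j : MvPolynomial (Fin n) k) ∈ Algebra.adjoin k (Set.range f) := by
        rw [hadj]; exact (g j).2
      rw [Algebra.adjoin_range_eq_range_aeval] at h1
      exact h1
    choose r hr using hrange
    have h2 := eq_zero_of_sum_aeval_mul_eq_zero hreg (e := fun β : B => e β) (T := T) (by
      intro c hc
      have h3 := linearIndependent_iff'.1 hind T c (by
        have h4 := Ideal.Quotient.eq_zero_iff_mem.2 hc
        rw [← h4, map_sum]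
        refine Finset.sum_congr rfl fun j _ => ?_
        rw [← smul_eq_C_mul]
        rfl)
      exact h3) r (by
      simp only [hr]
      exact hg) j hj
    have h5 := hr j
    rw [h2, map_zero] at h5
    exact Subtype.ext h5.symm
  have hsp : ⊤ ≤ Submodule.span ↥(invariants G) (Set.range fun β : B => e β) := by
    set M := Submodule.span ↥(invariants G) (Set.range fun β : B => e β) with hM
    have key : ∀ d, ∀ p : MvPolynomial (Fin n) k, homogeneousComponent d p ∈ M := by
      intro d
      induction d using Nat.strong_induction_on with
      | _ d ih =>
        intro p
        have h1 : mk p ∈ Submodule.span k ((fun α => mk (e α)) '' B) := by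
          rw [← p.support_sum_monomial_coeff, map_sum]
          refine Submodule.sum_mem _ fun α _ => ?_
          have h2 : monomial α (coeff α p) = coeff α p • e α := by
            simp [e, smul_monomial]
          rw [h2, map_smul]
          exact Submodule.smul_mem _ _ (hspan ⟨α, trivial, rfl⟩)
        have h2 : (fun α => mk (e α)) '' B = mk.toLinearMap '' (e '' B) := by
          rw [← Set.image_comp]; rfl
        rw [h2, ← Submodule.map_span] at h1
        obtain ⟨u, hu, hup⟩ := h1
        have h3 : p - u ∈ I := by
          rw [← Ideal.Quotient.mk_eq_mk_iff_sub_mem]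
          exact hup.symm
        have h4 : homogeneousComponent d u ∈ M := by
          clear hup h3
          induction hu using Submodule.span_induction with
          | mem x hx =>
            obtain ⟨β, hβ, rfl⟩ := hx
            rw [homogeneousComponent_of_mem
              (show (e β).IsHomogeneous β.degree from isHomogeneous_monomial 1 rfl)]
            split_ifs
            · exact Submodule.subset_span ⟨⟨β, hβ⟩, rfl⟩
            · exact Submodule.zero_mem _
          | zero => simp
          | add x y _ _ hx hy => rw [map_add]; exact Submodule.add_mem _ hx hy
          | smul c x _ hx =>
            rw [map_smul]
            have := M.smul_mem (algebraMap k ↥(invariants G) c) hx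
            rwa [algebraMap_smul] at this
        have h5 : homogeneousComponent d (p - u) ∈ M := by
          rw [hI, Ideal.mem_span_range_iff_exists_fun] at h3
          obtain ⟨c, hc⟩ := h3
          rw [← hc, map_sum]
          refine Submodule.sum_mem _ fun i _ => ?_
          obtain ⟨di, hdi, hhom⟩ := hf i
          rw [mul_comm]
          rcases le_or_gt di d with hle | hlt
          · have h6 := homogeneousComponent_mul_of_isHomogeneous hhom (c i) (d - di)
            rw [Nat.add_sub_cancel' hle] at h6
            rw [h6]
            exact M.smul_mem ⟨f i, hfR i⟩ (ih (d - di) (by omega) (c i))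
          · rw [homogeneousComponent_mul_eq_zero_of_lt hhom _ hlt]
            exact Submodule.zero_mem _
        rw [← sub_add_cancel p u, map_add]
        exact Submodule.add_mem _ h5 h4
    intro p _
    rw [← sum_homogeneousComponent p]
    exact Submodule.sum_mem _ fun d _ => key d p
  exact ⟨B, Module.Basis.mk hli hsp, h0B (Set.mem_singleton 0),
    fun β => Module.Basis.mk_apply hli hsp β⟩

theorem isGradedSubalgebra_invariants (G : Subgroup (Matrix.GeneralLinearGroup ι k)) :
    IsGradedSubalgebra (invariants G) := fun f hf d σ hσ => by
  rw [← homogeneousComponent_algHom (galAct_X_isHomogeneous σ), hf σ hσ]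

theorem DSP_of_monomial_basis (G : Subgroup (Matrix.GeneralLinearGroup ι k))
    {B : Set (ι →₀ ℕ)} (h0 : 0 ∈ B)
    (b : Module.Basis B ↥(invariants G) (MvPolynomial ι k))
    (hb : ∀ β, b β = monomial (β : ι →₀ ℕ) (1 : k)) : DSP G := by
  refine ⟨b.coord ⟨0, h0⟩, fun r => ⟨r • b ⟨0, h0⟩, by simp⟩, fun p d hp => ?_⟩
  let r := b.repr p
  have hr' : ∀ j : B, ∃ r' : ↥(invariants G),
      homogeneousComponent d ((r j : MvPolynomial ι k) * b j) = r' * b j ∧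
      ((j : ι →₀ ℕ) = 0 → (r' : MvPolynomial ι k).IsHomogeneous d) := by
    intro j
    have hj : (b j).IsHomogeneous (j : ι →₀ ℕ).degree := by
      rw [hb]; exact isHomogeneous_monomial 1 rfl
    rcases le_or_gt (j : ι →₀ ℕ).degree d with hle | hlt
    · refine ⟨⟨homogeneousComponent (d - (j : ι →₀ ℕ).degree) (r j : MvPolynomial ι k),
        isGradedSubalgebra_invariants G _ (r j).2 _⟩, ?_, ?_⟩
      · have h6 := homogeneousComponent_mul_of_isHomogeneous hj (r j : MvPolynomial ι k)
          (d - (j : ι →₀ ℕ).degree)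
        rw [Nat.add_sub_cancel' hle] at h6
        rw [mul_comm, h6, mul_comm]
      · intro h
        simp only [h, map_zero, Nat.sub_zero]
        exact homogeneousComponent_isHomogeneous d _
    · refine ⟨0, ?_, fun _ => isHomogeneous_zero _ _ _⟩
      rw [mul_comm, homogeneousComponent_mul_eq_zero_of_lt hj _ hlt]
      simp
  choose r' hr1 hr2 using hr'
  have hsum : ∑ j ∈ r.support, r j • b j = p := b.linearCombination_repr p
  have hsum' : ∑ j ∈ r.support, r' j • b j = p := by
    have h1 := congrArg (homogeneousComponent d) hsum
    rw [homogeneousComponent_of_mem hp, if_pos rfl, map_sum] at h1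
    conv_rhs => rw [← h1]
    exact Finset.sum_congr rfl fun j _ => (hr1 j).symm
  have h2 := linearIndependent_iff'.1 b.linearIndependent r.support (fun j => r j - r' j) (by
    simp only [sub_smul, Finset.sum_sub_distrib, hsum, hsum', sub_self])
  rw [Module.Basis.coord_apply]
  by_cases h : (⟨0, h0⟩ : B) ∈ r.support
  · have h3 := sub_eq_zero.1 (h2 _ h)
    change ((r ⟨0, h0⟩ : ↥(invariants G)) : MvPolynomial ι k).IsHomogeneous d
    rw [h3]
    exact hr2 _ rfl
  · have h3 : r ⟨0, h0⟩ = 0 := Finsupp.notMem_support_iff.1 h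
    change ((r ⟨0, h0⟩ : ↥(invariants G)) : MvPolynomial ι k).IsHomogeneous d
    rw [h3]
    exact isHomogeneous_zero _ _ _

theorem exists_smul_indicator_mem {T A : Type*} [Finite T] [CommRing A]
    (Γ : Subalgebra A (T → A)) (W : Set T) (q : Ideal A) [q.IsPrime]
    (h : ∀ σ ∈ W, ∀ τ ∉ W, ∃ x ∈ Γ, x σ - x τ ∉ q) :
    ∃ s ∉ q, s • W.indicator (1 : T → A) ∈ Γ := by
  classical
  have := Fintype.ofFinite T
  have h1 : ∀ σ ∈ W, ∃ y ∈ Γ, y σ ∉ q ∧ ∀ τ ∉ W, y τ = 0 := by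
    intro σ hσ
    have h2 : ∀ τ : T, ∃ x ∈ Γ, x σ ∉ q ∧ (τ ∉ W → x τ = 0) := by
      intro τ
      by_cases hτ : τ ∈ W
      · exact ⟨1, Γ.one_mem, (Ideal.ne_top_iff_one q).1 (Ideal.IsPrime.ne_top ‹_›),
          fun h => absurd hτ h⟩
      · obtain ⟨x, hx, hxq⟩ := h σ hσ τ hτ
        exact ⟨x - algebraMap A _ (x τ), Γ.sub_mem hx (Γ.algebraMap_mem _), hxq,
          fun _ => sub_self _⟩
    choose x hx hxq hx0 using h2
    refine ⟨∏ τ, x τ, Γ.prod_mem fun τ _ => hx τ, ?_, fun τ hτ => ?_⟩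
    · rw [Finset.prod_apply, Ideal.IsPrime.prod_mem_iff]
      rintro ⟨τ, -, hτ⟩
      exact hxq τ hτ
    · rw [Finset.prod_apply]
      exact Finset.prod_eq_zero (Finset.mem_univ τ) (hx0 τ hτ)
  choose! y hy hyq hy0 using h1
  let S : Finset T := Finset.univ.filter (· ∈ W)
  have hS : ∀ σ, σ ∈ S ↔ σ ∈ W := by simp [S]
  refine ⟨∏ σ ∈ S, y σ σ, ?_, ?_⟩
  · rw [Ideal.IsPrime.prod_mem_iff]
    rintro ⟨σ, hσ, h2⟩
    exact hyq σ ((hS σ).1 hσ) h2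
  · have h3 : (∏ σ ∈ S, y σ σ) • W.indicator (1 : T → A) =
        algebraMap A _ (∏ σ ∈ S, y σ σ) -
          ∏ σ ∈ S, (algebraMap A (T → A) (y σ σ) - y σ) := by
      ext τ
      simp only [Pi.smul_apply, smul_eq_mul, Pi.sub_apply, Finset.prod_apply,
        Pi.algebraMap_apply, Algebra.algebraMap_self, RingHom.id_apply]
      by_cases hτ : τ ∈ W
      · have h4 : ∏ σ ∈ S, (y σ σ - y σ τ) = 0 :=
          Finset.prod_eq_zero ((hS τ).2 hτ) (sub_self _)
        simp [h4, hτ]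
      · have h4 : ∏ σ ∈ S, (y σ σ - y σ τ) = ∏ σ ∈ S, y σ σ :=
          Finset.prod_congr rfl fun σ hσ => by rw [hy0 σ ((hS σ).1 hσ) τ hτ, sub_zero]
        simp [h4, hτ]
    rw [h3]
    exact Γ.sub_mem (Γ.algebraMap_mem _) (Γ.prod_mem fun σ hσ =>
      Γ.sub_mem (Γ.algebraMap_mem _) (hy σ ((hS σ).1 hσ)))

theorem mem_span_of_forall_prime_smul_mem {A M J : Type*} [CommRing A] [IsDomain A]
    [UniqueFactorizationMonoid A] [AddCommGroup M] [Module A M] [Module.IsTorsionFree A M]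
    {v : J → M} (hv : LinearIndependent A v) {u : M}
    (h0 : ∃ s : A, s ≠ 0 ∧ s • u ∈ Submodule.span A (Set.range v))
    (h : ∀ q : A, Prime q → ∃ s, ¬ q ∣ s ∧ s • u ∈ Submodule.span A (Set.range v)) :
    u ∈ Submodule.span A (Set.range v) := by
  obtain ⟨s, hs, hsu⟩ := h0
  induction s using UniqueFactorizationMonoid.induction_on_prime with
  | h₁ => exact absurd rfl hs
  | h₂ x hx =>
    obtain ⟨y, rfl⟩ := hx
    simpa [smul_smul] using Submodule.smul_mem _ (↑y⁻¹ : A) hsu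
  | h₃ a q ha hq ih =>
    refine ih ha ?_
    obtain ⟨s, hqs, hs'⟩ := h q hq
    have h1 : s • a • u ∈ Submodule.span A (Set.range v) := by
      rw [smul_comm]; exact Submodule.smul_mem _ _ hs'
    rw [mul_smul] at hsu
    obtain ⟨c, hc⟩ := (Finsupp.mem_span_range_iff_exists_finsupp).1 hsu
    obtain ⟨d, hd⟩ := (Finsupp.mem_span_range_iff_exists_finsupp).1 h1
    have h2 : s • c = q • d := by
      apply hv
      rw [map_smul, map_smul, Finsupp.linearCombination_apply, Finsupp.linearCombination_apply,
        hc, hd, smul_comm]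
    have h3 : ∀ j, q ∣ c j := fun j =>
      (hq.dvd_or_dvd ⟨d j, by simpa using DFunLike.congr_fun h2 j⟩ : q ∣ s ∨ q ∣ c j).resolve_left
        hqs
    choose e he using h3
    have h4 : q • (a • u - ∑ j ∈ c.support, e j • v j) = 0 := by
      rw [smul_sub, ← hc, Finsupp.sum, Finset.smul_sum, sub_eq_zero]
      exact Finset.sum_congr rfl fun j _ => by rw [smul_smul, ← he]
    rw [smul_eq_zero, or_iff_right hq.ne_zero, sub_eq_zero] at h4
    rw [h4]
    exact Submodule.sum_mem _ fun j _ => Submodule.smul_mem _ _ (Submodule.subset_span ⟨j, rfl⟩)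

theorem exists_eq_vecMulVec_of_dvd {m : Type*} {q : MvPolynomial ι k} (hq : ¬ IsUnit q)
    (N : Matrix m ι k) (h : ∀ i, q ∣ Fintype.linearCombination k X (N i)) :
    ∃ (c : m → k) (w : ι → k), N = Matrix.vecMulVec c w := by
  have hcoeff : ∀ (w : ι → k) (j : ι), coeff (Finsupp.single j 1)
      (Fintype.linearCombination k (X : ι → MvPolynomial ι k) w) = w j := by
    intro w j
    simp [Fintype.linearCombination_apply, coeff_sum, coeff_X, Finsupp.single_left_inj]
  have hdvd : ∀ i, ∃ c : k, Fintype.linearCombination k (X : ι → MvPolynomial ι k) (N i) =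
      C c * q := by
    intro i
    by_cases h0 : Fintype.linearCombination k (X : ι → MvPolynomial ι k) (N i) = 0
    · exact ⟨0, by simp [h0]⟩
    obtain ⟨g, hg⟩ := h i
    have hq0 : q ≠ 0 := by rintro rfl; exact h0 (by simp [hg])
    have hg0 : g ≠ 0 := by rintro rfl; exact h0 (by simp [hg])
    have hdeg : (Fintype.linearCombination k (X : ι → MvPolynomial ι k) (N i)).totalDegree ≤ 1 := by
      rw [Fintype.linearCombination_apply]
      refine totalDegree_finsetSum_le fun j _ => (totalDegree_smul_le _ _).trans ?_
      exact (totalDegree_X j).le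
    rw [hg, totalDegree_mul_of_isDomain hq0 hg0] at hdeg
    have hqd : q.totalDegree ≠ 0 := by
      intro h1
      rw [totalDegree_eq_zero_iff_eq_C] at h1
      apply hq
      rw [h1]
      refine (isUnit_iff_ne_zero.2 fun h2 => hq0 ?_).map C
      rw [h1, h2, map_zero]
    have hgd : g.totalDegree = 0 := by omega
    rw [totalDegree_eq_zero_iff_eq_C] at hgd
    exact ⟨_, by rw [hg, mul_comm, ← hgd]⟩
  choose c hc using hdvd
  refine ⟨c, fun j => coeff (Finsupp.single j 1) q, ?_⟩
  ext i j
  rw [Matrix.vecMulVec_apply, ← hcoeff (N i) j, hc, coeff_C_mul]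

theorem galAct_X_sub_galAct_X (σ τ : Matrix.GeneralLinearGroup ι k) (i : ι) :
    galAct σ (X i) - galAct τ (X i) = Fintype.linearCombination k X
      ((((σ⁻¹ : Matrix.GeneralLinearGroup ι k) : Matrix ι ι k) -
        ((τ⁻¹ : Matrix.GeneralLinearGroup ι k) : Matrix ι ι k)) i) := by
  simp [galAct_X, Fintype.linearCombination_apply, sub_smul, Finset.sum_sub_distrib]

theorem isPseudoReflection_of_forall_dvd {σ τ : Matrix.GeneralLinearGroup ι k} (hne : σ ≠ τ)
    {q : MvPolynomial ι k} (hq : ¬ IsUnit q)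
    (h : ∀ i, q ∣ galAct σ (X i) - galAct τ (X i)) : IsPseudoReflection (σ⁻¹ * τ) := by
  simp only [galAct_X_sub_galAct_X] at h
  obtain ⟨c, w, hcw⟩ := exists_eq_vecMulVec_of_dvd hq _ h
  have h1 : (((σ⁻¹ : Matrix.GeneralLinearGroup ι k) : Matrix ι ι k) -
      ((τ⁻¹ : Matrix.GeneralLinearGroup ι k) : Matrix ι ι k)) * (τ : Matrix ι ι k) =
      ((σ⁻¹ * τ : Matrix.GeneralLinearGroup ι k) : Matrix ι ι k) - 1 := by
    rw [sub_mul, ← Units.val_mul, ← Units.val_mul, inv_mul_cancel, Units.val_one]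
  change Matrix.rank (((σ⁻¹ * τ : Matrix.GeneralLinearGroup ι k) : Matrix ι ι k) - 1) = 1
  refine le_antisymm ?_ (Nat.one_le_iff_ne_zero.2 fun h2 => hne ?_)
  · rw [← h1]
    exact (Matrix.rank_mul_le_left _ _).trans (hcw ▸ Matrix.rank_vecMulVec_le c w)
  · rw [Matrix.rank, Submodule.finrank_eq_zero, LinearMap.range_eq_bot,
      ← Matrix.toLin'_apply', LinearEquiv.map_eq_zero_iff, sub_eq_zero, ← Units.val_one,
      Units.val_inj] at h2
    exact inv_mul_eq_one.1 h2

theorem galAct_injective_left :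
    Function.Injective (galAct : Matrix.GeneralLinearGroup ι k → _) := by
  intro σ τ h
  have h1 : ((σ⁻¹ : Matrix.GeneralLinearGroup ι k) : Matrix ι ι k) =
      ((τ⁻¹ : Matrix.GeneralLinearGroup ι k) : Matrix ι ι k) := by
    ext i j
    have h2 := congrArg (coeff (Finsupp.single j 1)) (DFunLike.congr_fun h (X i))
    simpa [galAct_X, coeff_sum, coeff_X, Finsupp.single_left_inj] using h2
  exact inv_injective (Units.ext h1)

theorem linearIndependent_galAct_basis (G : Subgroup (Matrix.GeneralLinearGroup ι k)) [Finite ↥G]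
    {J : Type*} (b : Module.Basis J ↥(invariants G) (MvPolynomial ι k)) :
    LinearIndependent (MvPolynomial ι k)
      (fun j (σ : ↥G) => galAct (σ : Matrix.GeneralLinearGroup ι k) (b j)) := by
  have := Fintype.ofFinite ↥G
  rw [linearIndependent_iff']
  intro T s hs i hi
  have hrel : ∀ σ : ↥G, ∑ j ∈ T, s j * galAct (σ : Matrix.GeneralLinearGroup ι k) (b j) = 0 := by
    intro σ
    simpa using congrFun hs σ
  let tr : MvPolynomial ι k → ↥(invariants G) := fun p =>
    ⟨∑ σ : ↥G, galAct (σ : Matrix.GeneralLinearGroup ι k) p, fun τ hτ => by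
      rw [map_sum]
      simp only [← galAct_mul_apply]
      exact Fintype.sum_equiv (Equiv.mulLeft (⟨τ, hτ⟩ : ↥G)) _ _ fun σ => rfl⟩
  have htr : ∀ t, tr (t * s i) = 0 := by
    intro t
    refine linearIndependent_iff'.1 b.linearIndependent T (fun j => tr (t * s j)) ?_ i hi
    have h1 : ∀ σ : ↥G, ∑ j ∈ T,
        galAct (σ : Matrix.GeneralLinearGroup ι k) (t * s j) * b j = 0 := by
      intro σ
      have h2 := congrArg (fun p => galAct (σ : Matrix.GeneralLinearGroup ι k) (t * p)) (hrel σ⁻¹)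
      simp only [Finset.mul_sum, map_sum, mul_zero, map_zero, ← mul_assoc] at h2
      rw [← h2]
      refine Finset.sum_congr rfl fun j _ => ?_
      rw [map_mul (galAct _) (t * s j), ← galAct_mul_apply, InvMemClass.coe_inv, mul_inv_cancel,
        galAct_one_apply]
    calc ∑ j ∈ T, tr (t * s j) • b j
        = ∑ j ∈ T, ∑ σ : ↥G, galAct (σ : Matrix.GeneralLinearGroup ι k) (t * s j) * b j := by
          refine Finset.sum_congr rfl fun j _ => ?_
          rw [← Finset.sum_mul]
          rfl
      _ = 0 := by
          rw [Finset.sum_comm]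
          exact Finset.sum_eq_zero fun σ _ => h1 σ
  have hinj : Function.Injective fun σ : ↥G =>
      ((galAct (σ : Matrix.GeneralLinearGroup ι k) : MvPolynomial ι k →ₐ[k] MvPolynomial ι k) :
        MvPolynomial ι k →* MvPolynomial ι k) := by
    intro σ τ h
    exact Subtype.ext (galAct_injective_left (AlgHom.ext fun p => DFunLike.congr_fun h p))
  have hded := (linearIndependent_monoidHom (MvPolynomial ι k) (MvPolynomial ι k)).comp _ hinj
  have h3 := Fintype.linearIndependent_iff.1 hded
    (fun σ => galAct (σ : Matrix.GeneralLinearGroup ι k) (s i)) (by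
      ext1 t
      have h4 := congrArg Subtype.val (htr t)
      simp only [tr, map_mul] at h4
      simpa [mul_comm] using h4) 1
  exact galAct_injective _ (h3.trans (map_zero _).symm)

theorem adjoin_galAct_le_span (G : Subgroup (Matrix.GeneralLinearGroup ι k))
    {J : Type*} (b : Module.Basis J ↥(invariants G) (MvPolynomial ι k)) :
    Subalgebra.toSubmodule (Algebra.adjoin (MvPolynomial ι k)
      (Set.range fun p (σ : ↥G) => galAct (σ : Matrix.GeneralLinearGroup ι k) p)) ≤
    Submodule.span (MvPolynomial ι k)
      (Set.range fun j (σ : ↥G) => galAct (σ : Matrix.GeneralLinearGroup ι k) (b j)) := by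
  let orb : MvPolynomial ι k →* (↥G → MvPolynomial ι k) :=
    { toFun := fun p σ => galAct (σ : Matrix.GeneralLinearGroup ι k) p
      map_one' := by ext1 σ; exact map_one _
      map_mul' := fun p q => by ext1 σ; exact map_mul _ _ _ }
  have h1 : (Submonoid.closure
      (Set.range fun p (σ : ↥G) => galAct (σ : Matrix.GeneralLinearGroup ι k) p) :
        Set (↥G → MvPolynomial ι k)) = Set.range orb := by
    have : Submonoid.closure (MonoidHom.mrange orb : Set (↥G → MvPolynomial ι k)) =
      MonoidHom.mrange orb := Submonoid.closure_eq _
    exact congrArg _ this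
  rw [Algebra.adjoin_eq_span, h1, Submodule.span_le]
  rintro _ ⟨p, rfl⟩
  have h2 : orb p = ∑ j ∈ (b.repr p).support, ((b.repr p) j : MvPolynomial ι k) • orb (b j) := by
    ext1 σ
    have h3 : ∑ j ∈ (b.repr p).support, (b.repr p) j • b j = p := b.linearCombination_repr p
    change galAct _ p = _
    conv_lhs => rw [← h3]
    rw [map_sum, Finset.sum_apply]
    refine Finset.sum_congr rfl fun j _ => ?_
    change galAct _ (((b.repr p) j : MvPolynomial ι k) * b j) = _
    rw [map_mul, (b.repr p j).2 _ σ.2]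
    rfl
  rw [h2]
  exact Submodule.sum_mem _ fun j _ => Submodule.smul_mem _ _ (Submodule.subset_span ⟨j, rfl⟩)

theorem constantCoeff_galAct (σ : Matrix.GeneralLinearGroup ι k) (p : MvPolynomial ι k) :
    constantCoeff (galAct σ p) = constantCoeff p := by
  have : (constantCoeff : MvPolynomial ι k →+* k).comp (galAct σ).toRingHom = constantCoeff := by
    ext i
    · simp [galAct]
    · simp [galAct_X]
  exact DFunLike.congr_fun this p

theorem closure_isPseudoReflection_eq (G : Subgroup (Matrix.GeneralLinearGroup ι k)) [Finite ↥G]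
    {J : Type*} (b : Module.Basis J ↥(invariants G) (MvPolynomial ι k)) :
    Subgroup.closure {σ | σ ∈ G ∧ IsPseudoReflection σ} = G := by
  refine le_antisymm ((Subgroup.closure_le G).2 fun σ h => h.1) ?_
  let W : Set ↥G := {σ | (σ : Matrix.GeneralLinearGroup ι k) ∈
    Subgroup.closure {σ | σ ∈ G ∧ IsPseudoReflection σ}}
  have hsep : ∀ q : MvPolynomial ι k, ¬ IsUnit q → ∀ σ ∈ W, ∀ τ ∉ W,
      ∃ x ∈ Algebra.adjoin (MvPolynomial ι k)
        (Set.range fun p (σ : ↥G) => galAct (σ : Matrix.GeneralLinearGroup ι k) p),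
        x σ - x τ ∉ Ideal.span {q} := by
    intro q hq σ hσ τ hτ
    by_contra! hcon
    have hdvd : ∀ i, q ∣ galAct (σ : Matrix.GeneralLinearGroup ι k) (X i) -
        galAct (τ : Matrix.GeneralLinearGroup ι k) (X i) := by
      intro i
      rw [← Ideal.mem_span_singleton]
      exact hcon (fun σ : ↥G => galAct (σ : Matrix.GeneralLinearGroup ι k) (X i))
        (Algebra.subset_adjoin (Set.mem_range_self (X i)))
    have hne : (σ : Matrix.GeneralLinearGroup ι k) ≠ τ := fun h => hτ (Subtype.ext h ▸ hσ)
    have h1 := isPseudoReflection_of_forall_dvd hne hq hdvd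
    have h2 := Subgroup.mul_mem _ hσ (Subgroup.subset_closure (k :=
      {σ | σ ∈ G ∧ IsPseudoReflection σ}) ⟨G.mul_mem (G.inv_mem σ.2) τ.2, h1⟩)
    rw [mul_inv_cancel_left] at h2
    exact hτ h2
  have hmem := mem_span_of_forall_prime_smul_mem (u := W.indicator 1)
    (linearIndependent_galAct_basis G b) ?_ ?_
  · have hconst : ∀ x ∈ Submodule.span (MvPolynomial ι k)
        (Set.range fun j (σ : ↥G) => galAct (σ : Matrix.GeneralLinearGroup ι k) (b j)),
        ∀ σ, constantCoeff (x σ) = constantCoeff (x 1) := by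
      intro x hx σ
      induction hx using Submodule.span_induction with
      | mem x hx =>
        obtain ⟨j, rfl⟩ := hx
        simp only [constantCoeff_galAct]
      | zero => rfl
      | add x y _ _ hx hy => rw [Pi.add_apply, Pi.add_apply, map_add, map_add, hx, hy]
      | smul a x _ hx => rw [Pi.smul_apply, Pi.smul_apply, smul_eq_mul, smul_eq_mul, map_mul,
          map_mul, hx]
    intro σ hσ
    by_contra hσW
    have h1W : (1 : ↥G) ∈ W :=
      Subgroup.one_mem (Subgroup.closure {σ | σ ∈ G ∧ IsPseudoReflection σ})
    have h1 := hconst _ hmem ⟨σ, hσ⟩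
    rw [Set.indicator_of_notMem (s := W) hσW,
      Set.indicator_of_mem h1W] at h1
    simp at h1
  · have : (Ideal.span {(0 : MvPolynomial ι k)}).IsPrime := by
      rw [Ideal.span_singleton_eq_bot.2 rfl]
      exact Ideal.isPrime_bot
    obtain ⟨s, hs, h1⟩ := exists_smul_indicator_mem _ W _ (hsep 0 not_isUnit_zero)
    exact ⟨s, fun h => hs (by rw [h]; exact Ideal.zero_mem _), adjoin_galAct_le_span G b h1⟩
  · intro q hq
    have := (Ideal.span_singleton_prime hq.ne_zero).2 hq
    obtain ⟨s, hs, h1⟩ := exists_smul_indicator_mem _ W _ (hsep q hq.not_isUnit)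
    exact ⟨s, fun h => hs (Ideal.mem_span_singleton.2 h), adjoin_galAct_le_span G b h1⟩

/-- **Main theorem.** Let `G < GL(V)` be a finite abelian group acting
linearly on an `n`-dimensional vector space over an arbitrary field `k`. Then the action is
coregular — `k[V]^G` is generated by `n` algebraically independent homogeneous invariants of
positive degree, i.e. it is a polynomial ring — if and only if `G` is generated by
pseudo-reflections and the direct summand property holds (there is a surjective
degree-preserving `k[V]^G`-linear map `k[V] → k[V]^G`). -/
theorem statement15 {k : Type*} [Field k] {n : ℕ}
    (G : Subgroup (Matrix.GeneralLinearGroup (Fin n) k)) [Finite ↥G]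
    (habelian : ∀ a ∈ G, ∀ b ∈ G, a * b = b * a) :
    (∃ f : Fin n → MvPolynomial (Fin n) k,
        (∀ i, f i ∈ invariants G) ∧
        (∀ i, ∃ d, 0 < d ∧ (f i).IsHomogeneous d) ∧
        AlgebraicIndependent k f ∧
        Algebra.adjoin k (Set.range f) = invariants G) ↔
      (Subgroup.closure {σ | σ ∈ G ∧ IsPseudoReflection σ} = G ∧ DSP G) := by
  constructor
  · rintro ⟨f, -, hf, -, hadj⟩
    obtain ⟨B, b, h0, hb⟩ := exists_monomial_basis G hf hadj
    exact ⟨closure_isPseudoReflection_eq G b, DSP_of_monomial_basis G h0 b hb⟩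
  · rintro ⟨hG, hD⟩
    exact coregular_of_closure_of_DSP G habelian hG hD
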